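/- arXiv:2209.08201 — 4 statements merged into one kernel-verified Lean document; each statement's English description precedes it below -/
import Mathlib

section
/- For all nonnegative integers n, ℓ ≥ 1 and s with n ≥ s + 2ℓ, the sets Dyck(n,ℓ,s) and Dyck(n,ℓ,n−s−2ℓ) have the same cardinality. -/
/-! ## Skew Young tableaux -/

/-- Cells (row, col), 0-indexed, of the skew diagram with `b-2` single cells in
column `i` on top, two full rows of length `i+1`, and `a-2` single cells in column `0` below. -/
def skytCells (a i b : ℕ) : Finset (ℕ × ℕ) :=
  (Finset.range (a + b - 2) ×ˢ Finset.range (i + 1)).filter fun c =>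
    (c.1 + 2 < b → c.2 = i) ∧ (b ≤ c.1 → c.2 = 0)

/-- Skew standard Young tableaux of shape `[(i+1)^b, 1^(a-2)] / [(i-1)^(b-2)]`,
modelled as fillings of `skytCells a i b` by `1, …, a+b+2i-2`, increasing along
rows and columns, and vanishing outside the diagram. -/
def SkytSet (a i b : ℕ) : Set ((ℕ × ℕ) → ℕ) :=
  {f | (∀ c, c ∉ skytCells a i b → f c = 0) ∧
    Set.BijOn f (skytCells a i b : Set (ℕ × ℕ)) (Finset.Icc 1 (a + b + 2 * i - 2) : Set ℕ) ∧
    (∀ c ∈ skytCells a i b, ∀ d ∈ skytCells a i b, c.1 = d.1 → c.2 < d.2 → f c < f d) ∧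
    (∀ c ∈ skytCells a i b, ∀ d ∈ skytCells a i b, c.2 = d.2 → c.1 < d.1 → f c < f d)}

/-! ## Dyck paths -/

/-- Lengths of the maximal ascents (runs of `true`) of a word. -/
def ascentLengths (w : List Bool) : List ℕ :=
  ((w.splitBy (· == ·)).filter fun r => r.headD false).map List.length

/-- `DyckSet n l s`: Dyck paths (`true` = up-step) of semilength `n` with exactly `l`
long ascents, exactly `s` singletons, and no singleton after the last long ascent. -/
def DyckSet (n l s : ℕ) : Set (List Bool) :=
  {w | w.length = 2 * n ∧ w.count true = w.count false ∧
    (∀ p, p <+: w → p.count false ≤ p.count true) ∧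
    ((ascentLengths w).filter fun x => decide (2 ≤ x)).length = l ∧
    ((ascentLengths w).filter fun x => decide (x = 1)).length = s ∧
    ∀ j, (ascentLengths w).getD j 0 = 1 → ∃ k, j < k ∧ 2 ≤ (ascentLengths w).getD k 0}

/-! ## Dissections and triangulations -/

/-- A chord of the convex `n`-gon (vertices `1, …, n` counterclockwise): a pair of
non-adjacent vertices, recorded with the smaller endpoint first. -/
def IsChord (n : ℕ) (c : ℕ × ℕ) : Prop :=
  1 ≤ c.1 ∧ c.1 + 1 < c.2 ∧ c.2 ≤ n ∧ ¬(c.1 = 1 ∧ c.2 = n)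

/-- Two chords cross in the interior of the polygon. -/
def Crosses (c d : ℕ × ℕ) : Prop :=
  (c.1 < d.1 ∧ d.1 < c.2 ∧ c.2 < d.2) ∨ (d.1 < c.1 ∧ c.1 < d.2 ∧ d.2 < c.2)

/-- A dissection of the `n`-gon: a set of pairwise non-crossing chords. -/
def IsDissection (n : ℕ) (S : Finset (ℕ × ℕ)) : Prop :=
  (∀ c ∈ S, IsChord n c) ∧ (∀ c ∈ S, ∀ d ∈ S, c ≠ d → ¬Crosses c d)

/-- `DisSet n k`: dissections of the `n`-gon with exactly `k` chords. -/
def DisSet (n k : ℕ) : Set (Finset (ℕ × ℕ)) :=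
  {S | IsDissection n S ∧ S.card = k}

/-- A triangulation of the `n`-gon: a maximal set of pairwise non-crossing chords. -/
def IsTriangulation (n : ℕ) (S : Finset (ℕ × ℕ)) : Prop :=
  IsDissection n S ∧ ∀ c, IsChord n c → (∀ d ∈ S, ¬Crosses c d) → c ∈ S

/-- Fuelled recursive computation of the fan decomposition of the triangulation induced by
the chord set `S` on the vertex interval `[p, r]`: returns the list of pairs
(origin of fan, number of triangles of the fan), in the order of the recursive
fan decomposition (fan at the smallest vertex first, then the decompositions of the
sub-polygons in counterclockwise order). -/
def fanListAux (S : Finset (ℕ × ℕ)) : ℕ → ℕ → ℕ → List (ℕ × ℕ)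
  | 0, _, _ => []
  | fuel + 1, p, r =>
    if r ≤ p + 1 then []
    else
      let ws := ((S.filter fun c => c.1 = p ∧ p + 1 < c.2 ∧ c.2 < r).image Prod.snd).sort (· ≤ ·)
      let link := (p + 1) :: (ws ++ [r])
      (p, ws.length + 1) :: (link.zip link.tail).flatMap fun q => fanListAux S fuel q.1 q.2

/-- The fan decomposition `F(T)` of the triangulation `S` of the polygon on the vertex
interval `[p, r]`, as a list of (origin, fan size) pairs. -/
def fanList (S : Finset (ℕ × ℕ)) (p r : ℕ) : List (ℕ × ℕ) :=
  fanListAux S (r - p) p r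

/-- The sequence `δ(T) = (d_1, …, d_{k-1})` of differences of consecutive fan origins. -/
def deltaList (L : List (ℕ × ℕ)) : List ℕ :=
  ((L.map Prod.fst).zip (L.map Prod.fst).tail).map fun q => q.2 - q.1

/-- `TriSet n t s`: triangulations of the `n`-gon whose fan decomposition has `t + s` fans,
exactly `s` of them singular, the last one not singular. -/
def TriSet (n t s : ℕ) : Set (Finset (ℕ × ℕ)) :=
  {S | IsTriangulation n S ∧
    (fanList S 1 n).length = t + s ∧
    ((fanList S 1 n).filter fun fan => decide (fan.2 = 1)).length = s ∧
    ((fanList S 1 n).getLastD (0, 0)).2 ≠ 1}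

/-! ## Ordered set partitions -/

/-- The minimum of a finite set of naturals (0 by convention for `∅`). -/
def blockMin (A : Finset ℕ) : ℕ := (A.sort (· ≤ ·)).getD 0 0

/-- The second-smallest element of a finite set of naturals. -/
def blockSndMin (A : Finset ℕ) : ℕ := (A.sort (· ≤ ·)).getD 1 0

/-- An ordered set partition of `{1, …, n}` : a list of nonempty pairwise disjoint
blocks whose union is `{1, …, n}`. -/
def IsOSP (n : ℕ) (L : List (Finset ℕ)) : Prop :=
  (∀ A ∈ L, A.Nonempty) ∧ List.Pairwise Disjoint L ∧
    L.foldr (· ∪ ·) ∅ = Finset.Icc 1 n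

/-- Nomincreasing: the blocks' minima strictly increase, and the second-smallest elements
of the blocks of size at least 2 strictly increase (in the order the blocks appear). -/
def Nomincreasing (L : List (Finset ℕ)) : Prop :=
  (L.map blockMin).Chain' (· < ·) ∧
    ((L.filter fun A => decide (2 ≤ A.card)).map blockSndMin).Chain' (· < ·)

/-- The word `U^{a_1} D^{x_2-x_1} ⋯ U^{a_t} D^{n-x_t+x_1}` attached to an ordered set
partition of `{1, …, n}` with minima `x_j` and block sizes `a_j`. -/
def ospWord (n : ℕ) (L : List (Finset ℕ)) : List Bool :=
  let xs := L.map blockMin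
  let ds := ((xs.zip xs.tail).map fun q => q.2 - q.1) ++ [n - xs.getLastD 0 + xs.headD 0]
  ((L.map Finset.card).zip ds).flatMap fun q =>
    List.replicate q.1 true ++ List.replicate q.2 false

/-! ## The map `Nom` -/

/-- The `j`-th block (0-indexed) of `Nom(λ)` for a tableau `f ∈ SkytSet a i b`. -/
def nomBlock (a i b : ℕ) (f : ℕ × ℕ → ℕ) (j : ℕ) : Finset ℕ :=
  let N := a + b + 2 * i - 2
  let X := ((skytCells a i b).filter fun c => c.1 + 1 < b).image f
  let x := (X.sort (· ≤ ·)).getD j 0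
  let row := (Finset.range (i + 1)).filter fun c => f (b - 2, c) = x
  if row.Nonempty then
    let col := (row.sort (· ≤ ·)).getD 0 0
    if col = i then insert x (Finset.Icc (f (b - 1, col)) N \ X)
    else insert x (Finset.Icc (f (b - 1, col)) (f (b - 1, col + 1) - 1) \ X)
  else {x}

/-- The nomincreasing ordered set partition `Nom(λ)` of a tableau `λ ∈ SkytSet a i b`. -/
def Nom (a i b : ℕ) (f : ℕ × ℕ → ℕ) : List (Finset ℕ) :=
  (List.range (i + b - 1)).map (nomBlock a i b f)

/-- The Dyck word `U^{u_1} D^{d_1} ⋯ U^{u_{t+s}} D^{d_{t+s}}` attached to a triangulation. -/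
def triWord (n : ℕ) (S : Finset (ℕ × ℕ)) : List Bool :=
  let L := fanList S 1 n
  let xs := L.map Prod.fst
  let ds := deltaList L ++ [n - xs.getLastD 0 + xs.headD 0 - 2]
  ((L.map Prod.snd).zip ds).flatMap fun q =>
    List.replicate q.1 true ++ List.replicate q.2 false

/-! ## Dyck paths as lists of ascent lengths -/

/-- The word `U^{c_1} D U^{c_2} D ⋯` in which exactly `c_i` up-steps directly precede the
`i`-th down-step. -/
def stepWord (c : List ℕ) : List Bool :=
  c.flatMap fun k => List.replicate k true ++ [false]

@[simp] lemma stepWord_nil : stepWord [] = [] := rfl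

@[simp] lemma stepWord_cons (k : ℕ) (c : List ℕ) :
    stepWord (k :: c) = List.replicate k true ++ false :: stepWord c := by
  simp [stepWord]

@[simp] lemma count_true_stepWord (c : List ℕ) : (stepWord c).count true = c.sum := by
  induction c with
  | nil => simp
  | cons k c ih => simp [ih]

@[simp] lemma count_false_stepWord (c : List ℕ) : (stepWord c).count false = c.length := by
  induction c with
  | nil => simp
  | cons k c ih => simp [ih, List.count_replicate]

lemma stepWord_injective : Function.Injective stepWord := by
  intro c
  induction c with
  | nil =>
    rintro (_ | ⟨k, d⟩) h
    · rfl
    · simp at h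
  | cons k c ih =>
    rintro (_ | ⟨m, d⟩) h
    · simp at h
    · have key : ∀ {k m : ℕ} {v w : List Bool},
          List.replicate k true ++ false :: v = List.replicate m true ++ false :: w →
            k = m ∧ v = w := by
        intro k
        induction k with
        | zero => rintro (_ | m) v w h <;> simp_all [List.replicate_succ]
        | succ k ih =>
          rintro (_ | m) v w h
          · simp [List.replicate_succ] at h
          · simp only [List.replicate_succ, List.cons_append, List.cons.injEq, true_and] at h
            have := ih h
            exact ⟨by omega, this.2⟩
      simp only [stepWord_cons] at h
      obtain ⟨rfl, h'⟩ := key h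
      rw [ih h']

lemma exists_eq_stepWord_append (w : List Bool) :
    ∃ c k, w = stepWord c ++ List.replicate k true := by
  induction w with
  | nil => exact ⟨[], 0, rfl⟩
  | cons b w ih =>
    obtain ⟨c, k, rfl⟩ := ih
    cases b with
    | false => exact ⟨0 :: c, k, by simp⟩
    | true =>
      cases c with
      | nil => exact ⟨[], k + 1, by simp [List.replicate_succ]⟩
      | cons m c => exact ⟨(m + 1) :: c, k, by simp [List.replicate_succ]⟩

lemma ballot_stepWord_iff (c : List ℕ) :
    (∀ p, p <+: stepWord c → p.count false ≤ p.count true) ↔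
      ∀ p, p <+: c → p.length ≤ p.sum := by
  constructor
  · rintro h p ⟨t, rfl⟩
    simpa using h (stepWord p) ⟨stepWord t, by simp [stepWord]⟩
  · suffices H : ∀ (c : List ℕ) (h : ℕ), (∀ p, p <+: c → p.length ≤ h + p.sum) →
        ∀ p, p <+: stepWord c → p.count false ≤ h + p.count true by
      intro h p hp
      simpa using H c 0 (by simpa using h) p hp
    intro c
    induction c with
    | nil =>
      intro h _ p hp
      simp [List.prefix_nil.1 hp]
    | cons k c ih =>
      intro h hc p hp
      have hc' : ∀ p, p <+: c → p.length + 1 ≤ h + (k + p.sum) := fun p hp => by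
        simpa using hc (k :: p) (List.cons_prefix_cons.2 ⟨rfl, hp⟩)
      clear hc
      rw [stepWord_cons] at hp
      induction k generalizing h p with
      | zero =>
        rcases p with _ | ⟨b, p⟩
        · simp
        · obtain ⟨rfl, hp'⟩ := List.cons_prefix_cons.1 hp
          have h0 := hc' [] List.nil_prefix
          have := ih (h - 1) (fun p hp => by have := hc' p hp; omega) p hp'
          simp at h0 ⊢
          omega
      | succ k ihk =>
        rcases p with _ | ⟨b, p⟩
        · simp
        · obtain ⟨rfl, hp'⟩ := List.cons_prefix_cons.1 hp
          have := ihk (h + 1) p hp' fun p hp => by have := hc' p hp; omega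
          simp
          omega

lemma splitBy_replicate (b : Bool) (k : ℕ) :
    (List.replicate (k + 1) b).splitBy (· == ·) = [List.replicate (k + 1) b] := by
  apply List.splitBy_of_isChain (by simp)
  apply List.Pairwise.isChain
  rw [List.pairwise_replicate]
  simp

lemma exists_eq_replicate_append (b : Bool) (w : List Bool) :
    ∃ k r, w = List.replicate k b ++ r ∧ ∀ y ∈ r.head?, y ≠ b := by
  induction w with
  | nil => exact ⟨0, [], by simp⟩
  | cons a w ih =>
    by_cases h : a = b
    · obtain ⟨k, r, rfl, hr⟩ := ih
      exact ⟨k + 1, r, by simp [List.replicate_succ, h], hr⟩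
    · exact ⟨0, a :: w, by simp, by simpa using h⟩

lemma ascentLengths_replicate_append (k : ℕ) {r : List Bool} (hr : ∀ y ∈ r.head?, y ≠ false) :
    ascentLengths (List.replicate k false ++ r) = ascentLengths r := by
  cases k with
  | zero => simp
  | succ k =>
    rw [ascentLengths, List.splitBy_append, splitBy_replicate]
    · simp [ascentLengths, List.replicate_succ]
    · intro x hx y hy
      have := hr y hy
      simp_all [List.getLast?_replicate]

lemma ascentLengths_false_cons (w : List Bool) :
    ascentLengths (false :: w) = ascentLengths w := by
  obtain ⟨k, r, rfl, hr⟩ := exists_eq_replicate_append false w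
  rw [ascentLengths_replicate_append k hr, ← ascentLengths_replicate_append (k + 1) hr,
    List.replicate_succ, List.cons_append]

lemma ascentLengths_stepWord (c : List ℕ) :
    ascentLengths (stepWord c) = c.filter (· ≠ 0) := by
  induction c with
  | nil => simp [ascentLengths]
  | cons k c ih =>
    rw [stepWord_cons]
    cases k with
    | zero => simpa [ascentLengths_false_cons] using ih
    | succ k =>
      rw [ascentLengths, List.splitBy_append_cons, splitBy_replicate, List.singleton_append,
        List.filter_cons_of_pos (by simp [List.replicate_succ]), List.map_cons,
        ← ascentLengths, ascentLengths_false_cons, ih]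
      · simp
      · simp [List.getLast?_replicate]

/-- For every nonzero entry of `c`, in order, whether it is at least `2`. -/
def longFlags (c : List ℕ) : List Bool := (c.filter (· ≠ 0)).map fun k => decide (2 ≤ k)

@[simp] lemma longFlags_nil : longFlags [] = [] := rfl

@[simp] lemma longFlags_zero_cons (c : List ℕ) : longFlags (0 :: c) = longFlags c := rfl

@[simp] lemma longFlags_one_cons (c : List ℕ) : longFlags (1 :: c) = false :: longFlags c := rfl

@[simp] lemma longFlags_add_two_cons (k : ℕ) (c : List ℕ) :
    longFlags ((k + 2) :: c) = true :: longFlags c := by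
  simp [longFlags]

/-- The lists `c` for which `stepWord c` lies in `DyckSet n l s`, when `l` is positive. -/
def AscentSet (n l s : ℕ) : Set (List ℕ) :=
  {c | c.length = n ∧ c.sum = n ∧ (∀ p, p <+: c → p.length ≤ p.sum) ∧
    (longFlags c).count true = l ∧ (longFlags c).count false = s ∧
    (longFlags c).getLast? = some true}

lemma getLast?_map_two_le_iff {a : List ℕ} (ha : a ≠ []) (hpos : ∀ x ∈ a, x ≠ 0) :
    (∀ j, a.getD j 0 = 1 → ∃ k, j < k ∧ 2 ≤ a.getD k 0) ↔
      (a.map fun k => decide (2 ≤ k)).getLast? = some true := by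
  obtain ⟨b, x, rfl⟩ := (List.eq_nil_or_concat' a).resolve_left ha
  have hx : x ≠ 0 := hpos x (by simp)
  have hlast : (b ++ [x]).getD b.length 0 = x := by simp
  suffices (∀ j, (b ++ [x]).getD j 0 = 1 → ∃ k, j < k ∧ 2 ≤ (b ++ [x]).getD k 0) ↔ 2 ≤ x by
    simpa using this
  constructor
  · intro h
    by_contra! hlt
    obtain ⟨k, hk, h2⟩ := h b.length (by omega)
    rw [List.getD_eq_default _ _ (by simp; omega)] at h2
    omega
  · intro h2 j hj
    refine ⟨b.length, ?_, by omega⟩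
    by_contra! hle
    rcases hle.eq_or_lt with rfl | hlt
    · omega
    · rw [List.getD_eq_default _ _ (by simp; omega)] at hj
      omega

lemma stepWord_mem_DyckSet_iff {n l s : ℕ} (hl : 1 ≤ l) (c : List ℕ) :
    stepWord c ∈ DyckSet n l s ↔ c ∈ AscentSet n l s := by
  have hlen : (stepWord c).length = c.sum + c.length := by
    rw [← List.count_true_add_count_false, count_true_stepWord, count_false_stepWord]
  have hpos : ∀ x ∈ c.filter (· ≠ 0), x ≠ 0 := by simp
  have hlong : ((c.filter (· ≠ 0)).filter fun x => decide (2 ≤ x)).length =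
      (longFlags c).count true := by
    rw [← List.countP_eq_length_filter, longFlags, List.count, List.countP_map]
    congr 1
    ext x
    simp
  have hone : ((c.filter (· ≠ 0)).filter fun x => decide (x = 1)).length =
      (longFlags c).count false := by
    rw [← List.countP_eq_length_filter, longFlags, List.count, List.countP_map]
    apply List.countP_congr
    intro x hx
    have := hpos x hx
    simp
    omega
  simp only [DyckSet, AscentSet, Set.mem_ofPred_eq, ascentLengths_stepWord, hlen, hlong, hone,
    ballot_stepWord_iff, count_true_stepWord, count_false_stepWord]
  by_cases ha : c.filter (· ≠ 0) = []
  · have : longFlags c = [] := by rw [longFlags, ha]; rfl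
    simp [this]
    omega
  · rw [getLast?_map_two_le_iff ha hpos, ← longFlags]
    constructor
    · rintro ⟨h1, h2, h3, h4⟩
      exact ⟨by omega, by omega, h3, h4⟩
    · rintro ⟨h1, h2, h3, h4⟩
      exact ⟨by omega, by omega, h3, h4⟩

lemma nonempty_DyckSet_equiv_AscentSet (n : ℕ) {l : ℕ} (hl : 1 ≤ l) (s : ℕ) :
    Nonempty (DyckSet n l s ≃ AscentSet n l s) := by
  refine ⟨(Equiv.ofBijective
    (fun c : AscentSet n l s => (⟨stepWord c, (stepWord_mem_DyckSet_iff hl _).2 c.2⟩ :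
      DyckSet n l s)) ⟨fun c d h => ?_, ?_⟩).symm⟩
  · exact Subtype.ext (stepWord_injective (congrArg Subtype.val h))
  · rintro ⟨w, hw⟩
    obtain ⟨c, k, rfl⟩ := exists_eq_stepWord_append w
    obtain rfl : k = 0 := by
      have h1 := hw.2.1
      have h2 := hw.2.2.1 (stepWord c) (List.prefix_append _ _)
      simp [List.count_replicate] at h1 h2
      omega
    simp only [List.replicate_zero, List.append_nil] at hw
    exact ⟨⟨c, (stepWord_mem_DyckSet_iff hl c).1 hw⟩, by simp⟩

/-! ## Two-lane words -/

/-- The labels of the letters of `w` whose lane is `z`. -/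
def lane (z : Bool) (w : List (Bool × Bool)) : List Bool :=
  (w.filter fun x => x.1 == z).map Prod.snd

@[simp] lemma lane_nil (z : Bool) : lane z [] = [] := rfl

@[simp] lemma lane_cons (z : Bool) (x : Bool × Bool) (w : List (Bool × Bool)) :
    lane z (x :: w) = if x.1 = z then x.2 :: lane z w else lane z w := by
  by_cases h : x.1 = z <;> simp [lane, h]

@[simp] lemma lane_append (z : Bool) (v w : List (Bool × Bool)) :
    lane z (v ++ w) = lane z v ++ lane z w := by
  simp [lane]

lemma length_lane_add_length_lane (w : List (Bool × Bool)) :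
    (lane true w).length + (lane false w).length = w.length := by
  induction w with
  | nil => rfl
  | cons x w ih =>
    obtain ⟨_ | _, b⟩ := x <;> simp <;> omega

/-- Words with `l` letters labelled `true` in each lane, with `s` letters labelled `false` in lane
`true` and `e` in lane `false`, such that the last letter of lane `true` and the first letter of
lane `false` are labelled `true`, and these `2 * l` letters form a ballot sequence. -/
def LaneSet (l s e : ℕ) : Set (List (Bool × Bool)) :=
  {w | (lane true w).count true = l ∧ (lane true w).count false = s ∧
    (lane true w).getLast? = some true ∧
    (lane false w).count true = l ∧ (lane false w).count false = e ∧
    (lane false w).head? = some true ∧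
    ∀ p, p <+: w → (lane false p).count true ≤ (lane true p).count true}

/-- Reverse a word and exchange its two lanes. -/
def laneFlip (w : List (Bool × Bool)) : List (Bool × Bool) :=
  (w.map fun x => (!x.1, x.2)).reverse

lemma laneFlip_involutive : Function.Involutive laneFlip := by
  intro w
  simp [laneFlip, Function.comp_def]

lemma lane_laneFlip (z : Bool) (w : List (Bool × Bool)) :
    lane z (laneFlip w) = (lane (!z) w).reverse := by
  induction w with
  | nil => rfl
  | cons x w ih =>
    have : laneFlip (x :: w) = laneFlip w ++ [(!x.1, x.2)] := by simp [laneFlip]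
    rw [this, lane_append, ih]
    obtain ⟨_ | _, b⟩ := x <;> cases z <;> simp

lemma laneFlip_mem_LaneSet {l s e : ℕ} {w : List (Bool × Bool)} (hw : w ∈ LaneSet l s e) :
    laneFlip w ∈ LaneSet l e s := by
  obtain ⟨h1, h2, h3, h4, h5, h6, h7⟩ := hw
  refine ⟨?_, ?_, ?_, ?_, ?_, ?_, ?_⟩
  · simpa [lane_laneFlip] using h4
  · simpa [lane_laneFlip] using h5
  · simpa [lane_laneFlip] using h6
  · simpa [lane_laneFlip] using h1
  · simpa [lane_laneFlip] using h2
  · simpa [lane_laneFlip] using h3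
  · rintro p ⟨t, ht⟩
    have hw : laneFlip t ++ laneFlip p = w := by
      rw [← laneFlip_involutive w, ← ht]
      simp [laneFlip]
    have h := h7 (laneFlip t) ⟨_, hw⟩
    rw [← hw] at h1 h4
    simp [lane_laneFlip] at h h1 h4
    omega

lemma nonempty_LaneSet_equiv_LaneSet (l s e : ℕ) : Nonempty (LaneSet l s e ≃ LaneSet l e s) :=
  ⟨laneFlip_involutive.toPerm.subtypeEquiv fun w =>
    ⟨laneFlip_mem_LaneSet, fun h => by
      simpa [laneFlip_involutive w] using laneFlip_mem_LaneSet h⟩⟩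

/-! ## The correspondence -/

/-- The lane-`false` labels produced by the entries of `c`: an entry `k + 2` produces
`true` followed by `k` copies of `false`. -/
def laneLabels (c : List ℕ) : List Bool :=
  c.flatMap fun k => if 2 ≤ k then true :: List.replicate (k - 2) false else []

@[simp] lemma laneLabels_nil : laneLabels [] = [] := rfl

@[simp] lemma laneLabels_zero_cons (c : List ℕ) : laneLabels (0 :: c) = laneLabels c := rfl

@[simp] lemma laneLabels_one_cons (c : List ℕ) : laneLabels (1 :: c) = laneLabels c := rfl

@[simp] lemma laneLabels_add_two_cons (k : ℕ) (c : List ℕ) :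
    laneLabels ((k + 2) :: c) = true :: (List.replicate k false ++ laneLabels c) := by
  simp [laneLabels]

/-- `QueueRun q c w`: starting from the queue `q`, reading `c` outputs `w` and empties the queue.
Each positive entry outputs a letter of lane `true`; an entry `k + 2` moreover enqueues the labels
`true, false, …, false` (with `k` copies of `false`), and an entry `0` outputs in lane `false`
the first label of the queue. -/
inductive QueueRun : List Bool → List ℕ → List (Bool × Bool) → Prop
  | nil : QueueRun [] [] []
  | zero {q c w} (x : Bool) : QueueRun q c w → QueueRun (x :: q) (0 :: c) ((false, x) :: w)
  | one {q c w} : QueueRun q c w → QueueRun q (1 :: c) ((true, false) :: w)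
  | long {q c w} (k : ℕ) : QueueRun (q ++ true :: List.replicate k false) c w →
      QueueRun q ((k + 2) :: c) ((true, true) :: w)

namespace QueueRun

variable {q : List Bool} {c : List ℕ} {v w : List (Bool × Bool)}

lemma lane_true (h : QueueRun q c w) : lane true w = longFlags c := by
  induction h <;> simp_all

lemma lane_false (h : QueueRun q c w) : lane false w = q ++ laneLabels c := by
  induction h <;> simp_all

lemma length_eq (h : QueueRun q c w) : w.length = c.length := by
  induction h <;> simp_all

lemma length_add_sum (h : QueueRun q c w) : q.length + c.sum = c.length := by
  induction h <;> simp_all <;> omega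

lemma length_le_sum (h : QueueRun q c w) {p : List ℕ} (hp : p <+: c) :
    p.length ≤ q.length + p.sum := by
  induction h generalizing p with
  | nil => simp [List.prefix_nil.1 hp]
  | zero x _ ih | one _ ih | long k _ ih =>
    rcases p with _ | ⟨a, p⟩
    · simp
    · obtain ⟨rfl, hp'⟩ := List.cons_prefix_cons.1 hp
      have := ih hp'
      simp at this ⊢
      omega

lemma ballot (h : QueueRun q c w) {p : List (Bool × Bool)} (hp : p <+: w) :
    (lane false p).count true ≤ q.count true + (lane true p).count true := by
  induction h generalizing p with
  | nil => simp [List.prefix_nil.1 hp]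
  | zero x _ ih | one _ ih | long k _ ih =>
    rcases p with _ | ⟨a, p⟩
    · simp
    · obtain ⟨rfl, hp'⟩ := List.cons_prefix_cons.1 hp
      have := ih hp'
      simp [List.count_cons, List.count_replicate] at this ⊢
      omega

lemma word_unique (hv : QueueRun q c v) (hw : QueueRun q c w) : v = w := by
  induction hv generalizing w with
  | nil => cases hw; rfl
  | zero _ _ ih | one _ ih | long _ _ ih =>
    cases hw
    rw [ih (by assumption)]

end QueueRun

lemma eq_of_replicate_append_laneLabels {k m : ℕ} {c d : List ℕ}
    (h : List.replicate k false ++ laneLabels c = List.replicate m false ++ laneLabels d) :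
    k = m := by
  have hd : ∀ c : List ℕ, (laneLabels c).head? ≠ some false := by
    intro c
    induction c with
    | nil => simp
    | cons k c ih => rcases k with _ | _ | k <;> simp_all
  induction k generalizing m with
  | zero =>
    cases m with
    | zero => rfl
    | succ m => exact absurd (by simpa [List.replicate_succ] using congrArg List.head? h) (hd c)
  | succ k ih =>
    cases m with
    | zero =>
      exact absurd (by simpa [List.replicate_succ] using (congrArg List.head? h).symm) (hd d)
    | succ m => rw [ih (by simpa [List.replicate_succ] using h)]

lemma QueueRun.source_unique {q : List Bool} {c d : List ℕ} {w : List (Bool × Bool)}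
    (hc : QueueRun q c w) (hd : QueueRun q d w) : c = d := by
  induction hc generalizing d with
  | nil => cases hd; rfl
  | zero x _ ih =>
    cases hd with
    | zero _ hd => rw [ih hd]
  | one _ ih =>
    cases hd with
    | one hd => rw [ih hd]
  | long k hc ih =>
    cases hd with
    | long m hd =>
      obtain rfl : k = m := by
        have h := hc.lane_false.symm.trans hd.lane_false
        simp only [List.append_assoc, List.cons_append, List.append_cancel_left_eq,
          List.cons.injEq, true_and] at h
        exact eq_of_replicate_append_laneLabels h
      rw [ih hd]

lemma exists_queueRun_of_list {q : List Bool} {c : List ℕ} (hsum : q.length + c.sum = c.length)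
    (hpre : ∀ p, p <+: c → p.length ≤ q.length + p.sum) : ∃ w, QueueRun q c w := by
  induction c generalizing q with
  | nil =>
    obtain rfl : q = [] := by simpa using hsum
    exact ⟨_, .nil⟩
  | cons a c ih =>
    have hpre' : ∀ p, p <+: c → p.length + 1 ≤ q.length + (a + p.sum) := fun p hp => by
      simpa using hpre (a :: p) (List.cons_prefix_cons.2 ⟨rfl, hp⟩)
    simp only [List.sum_cons, List.length_cons] at hsum
    rcases a with _ | _ | k
    · rcases q with _ | ⟨x, q⟩
      · simpa using hpre' [] List.nil_prefix
      · obtain ⟨w, hw⟩ := @ih q (by simp at hsum; omega) fun p hp => by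
          have := hpre' p hp
          simp at this
          omega
        exact ⟨_, hw.zero x⟩
    · obtain ⟨w, hw⟩ := @ih q (by omega) fun p hp => by
        have := hpre' p hp
        omega
      exact ⟨_, hw.one⟩
    · obtain ⟨w, hw⟩ := @ih (q ++ true :: List.replicate k false) (by simp; omega) fun p hp => by
        have := hpre' p hp
        simp
        omega
      exact ⟨_, hw.long k⟩

lemma exists_queueRun_of_word {q r : List Bool} {w : List (Bool × Bool)}
    (hlane : lane false w = q ++ r) (hr : r.head? ≠ some false)
    (hcount : r.count true = (lane true w).count true)
    (hballot : ∀ p, p <+: w →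
      (lane false p).count true ≤ q.count true + (lane true p).count true) :
    ∃ c, QueueRun q c w := by
  induction w generalizing q r with
  | nil =>
    obtain ⟨rfl, rfl⟩ : q = [] ∧ r = [] := by simpa using hlane
    exact ⟨_, .nil⟩
  | cons a w ih =>
    have hballot' := fun p (hp : p <+: w) =>
      hballot (a :: p) (List.cons_prefix_cons.2 ⟨rfl, hp⟩)
    obtain ⟨_ | _, x⟩ := a
    · simp only [lane_cons, if_true] at hlane
      rcases q with _ | ⟨y, q⟩
      · cases x with
        | false => simp at hlane; simp [← hlane] at hr
        | true => simpa using hballot' [] List.nil_prefix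
      · simp only [List.cons_append, List.cons.injEq] at hlane
        obtain ⟨rfl, hlane⟩ := hlane
        obtain ⟨c, hc⟩ := ih hlane hr (by simpa using hcount) fun p hp => by
          have := hballot' p hp
          simp [List.count_cons] at this
          omega
        exact ⟨_, hc.zero x⟩
    · simp only [lane_cons, Bool.true_eq_false, if_false] at hlane
      cases x with
      | false =>
        obtain ⟨c, hc⟩ := ih hlane hr (by simpa using hcount) fun p hp => by
          simpa using hballot' p hp
        exact ⟨_, hc.one⟩
      | true =>
        rcases r with _ | ⟨_ | _, r⟩
        · simp at hcount
        · simp at hr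
        · obtain ⟨k, r, rfl, hr'⟩ := exists_eq_replicate_append false r
          obtain ⟨c, hc⟩ := @ih (q ++ true :: List.replicate k false) r (by simpa using hlane)
            (fun h => hr' _ h rfl) (by simpa [List.count_replicate] using hcount) fun p hp => by
              have := hballot' p hp
              simp [List.count_replicate] at this ⊢
              omega
          exact ⟨_, hc.long k⟩

lemma sum_eq_count (c : List ℕ) :
    c.sum = 2 * (longFlags c).count true + (longFlags c).count false +
      (laneLabels c).count false := by
  induction c with
  | nil => rfl
  | cons k c ih => rcases k with _ | _ | k <;> simp <;> omega

lemma count_true_laneLabels (c : List ℕ) :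
    (laneLabels c).count true = (longFlags c).count true := by
  induction c with
  | nil => rfl
  | cons k c ih => rcases k with _ | _ | k <;> simp [List.count_replicate, ih]

lemma head?_laneLabels (c : List ℕ) (h : true ∈ longFlags c) :
    (laneLabels c).head? = some true := by
  induction c with
  | nil => simp at h
  | cons k c ih => rcases k with _ | _ | k <;> simp_all

lemma QueueRun.mem_AscentSet_iff {l s e : ℕ} {c : List ℕ} {w : List (Bool × Bool)}
    (h : QueueRun [] c w) : c ∈ AscentSet (s + e + 2 * l) l s ↔ w ∈ LaneSet l s e := by
  have hsum := h.length_add_sum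
  have hcount := sum_eq_count c
  simp only [List.length_nil, Nat.zero_add] at hsum
  simp only [AscentSet, LaneSet, Set.mem_ofPred_eq, h.lane_true, h.lane_false, List.nil_append,
    count_true_laneLabels]
  constructor
  · rintro ⟨h1, h2, -, h4, h5, h6⟩
    exact ⟨h4, h5, h6, h4, by omega, head?_laneLabels c (List.mem_of_getLast? h6),
      fun p hp => by simpa using h.ballot hp⟩
  · rintro ⟨h1, h2, h3, -, h5, -⟩
    exact ⟨by omega, by omega, fun p hp => by simpa using h.length_le_sum hp, h1, h2, h3⟩

lemma nonempty_AscentSet_equiv_LaneSet (l s e : ℕ) :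
    Nonempty (AscentSet (s + e + 2 * l) l s ≃ LaneSet l s e) := by
  have hrun : ∀ c : AscentSet (s + e + 2 * l) l s, ∃ w, QueueRun [] c w := fun c =>
    exists_queueRun_of_list (by simp [c.2.1, c.2.2.1]) (by simpa using c.2.2.2.1)
  choose f hf using hrun
  refine ⟨Equiv.ofBijective (fun c => ⟨f c, (hf c).mem_AscentSet_iff.1 c.2⟩)
    ⟨fun c d hcd => ?_, fun w => ?_⟩⟩
  · have hd := hf d
    rw [← show f c = f d from congrArg Subtype.val hcd] at hd
    exact Subtype.ext ((hf c).source_unique hd)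
  · obtain ⟨h1, -, -, h4, -, h6, h7⟩ := w.2
    obtain ⟨c, hc⟩ := exists_queueRun_of_word (q := []) (w := w.1) (by simp) (by simp [h6])
      (h4.trans h1.symm) (by simpa using h7)
    exact ⟨⟨c, hc.mem_AscentSet_iff.2 w.2⟩, Subtype.ext ((hf ⟨c, _⟩).word_unique hc)⟩

/-- For all `n`, `l ≥ 1` and `s` with `n ≥ s + 2l`, `Dyck(n,l,s)` and
`Dyck(n,l,n-s-2l)` have the same cardinality. -/
theorem dyck_symm (n l s : ℕ) (hl : 1 ≤ l) (hn : s + 2 * l ≤ n) :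
    Nonempty (↥(DyckSet n l s) ≃ ↥(DyckSet n l (n - s - 2 * l))) := by
  obtain ⟨e, rfl⟩ : ∃ e, n = s + e + 2 * l := ⟨n - s - 2 * l, by omega⟩
  obtain ⟨f₁⟩ := nonempty_DyckSet_equiv_AscentSet (s + e + 2 * l) hl s
  obtain ⟨f₂⟩ := nonempty_AscentSet_equiv_LaneSet l s e
  obtain ⟨f₃⟩ := nonempty_LaneSet_equiv_LaneSet l s e
  obtain ⟨f₄⟩ := nonempty_AscentSet_equiv_LaneSet l e s
  obtain ⟨f₅⟩ := nonempty_DyckSet_equiv_AscentSet (s + e + 2 * l) hl e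
  rw [show s + e + 2 * l - s - 2 * l = e by omega]
  rw [add_comm e s] at f₄
  exact ⟨(((f₁.trans f₂).trans f₃).trans f₄.symm).trans f₅.symm⟩
end

section
/- For all nonnegative integers n, t ≥ 1 and s with n ≥ s + 2t + 2, the sets Tri(n,t,s) and Tri(n,t,n−s−2t−2) have the same cardinality. -/
/-! ## Binary trees and the fans they encode -/

/-- Binary trees. A tree with `m` inner nodes encodes a triangulation of an `(m + 2)`-gon: the root
is the triangle on the base edge, the two subtrees triangulate the polygons on its other sides. -/
inductive BinTree : Type
  | nil : BinTree
  | node (L R : BinTree) : BinTree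

/-- Motzkin trees with two kinds of unary nodes (`z` and `u`). -/
inductive Motz : Type
  | e : Motz
  | z (F : Motz) : Motz
  | u (F : Motz) : Motz
  | b (F G : Motz) : Motz

/-- Sequences of triples `(i, j, F)` in which `F` is an optional Motzkin tree, closed by a
pair `(i, j)`. They encode the binary trees whose last fan is not singular. -/
inductive Spine : Type
  | last (i j : ℕ) : Spine
  | bare (i j : ℕ) (a : Spine) : Spine
  | deco (i j : ℕ) (F : Motz) (a : Spine) : Spine

namespace Motz

/-- The number of binary nodes. -/
def branches : Motz → ℕ
  | e => 0
  | z F => F.branches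
  | u F => F.branches
  | b F G => F.branches + G.branches + 1

/-- The number of unary nodes of kind `u`. -/
def us : Motz → ℕ
  | e => 0
  | z F => F.us
  | u F => F.us + 1
  | b F G => F.us + G.us

/-- The number of unary nodes of kind `z`. -/
def zs : Motz → ℕ
  | e => 0
  | z F => F.zs + 1
  | u F => F.zs
  | b F G => F.zs + G.zs

/-- Exchange the two kinds of unary nodes. -/
def swap : Motz → Motz
  | e => e
  | z F => u F.swap
  | u F => z F.swap
  | b F G => b F.swap G.swap

theorem swap_swap (F : Motz) : F.swap.swap = F := by
  induction F <;> simp_all [swap]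

theorem branches_swap (F : Motz) : F.swap.branches = F.branches := by
  induction F <;> simp_all [swap, branches]

theorem us_swap (F : Motz) : F.swap.us = F.zs := by
  induction F <;> simp_all [swap, us, zs]

theorem zs_swap (F : Motz) : F.swap.zs = F.us := by
  rw [← us_swap, swap_swap]

end Motz

namespace Spine

/-- The number of binary nodes, counting one for each block of the spine. -/
def branches : Spine → ℕ
  | last _ _ => 1
  | bare _ _ a => a.branches + 1
  | deco _ _ F a => F.branches + a.branches + 1

/-- The number of unary nodes of kind `u`. -/
def us : Spine → ℕ
  | last i _ => i
  | bare i _ a => i + a.us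
  | deco i _ F a => i + F.us + a.us

/-- The number of unary nodes of kind `z`. -/
def zs : Spine → ℕ
  | last _ j => j
  | bare _ j a => j + a.zs
  | deco _ j F a => j + F.zs + a.zs

/-- Exchange the two kinds of unary nodes. -/
def swap : Spine → Spine
  | last i j => last j i
  | bare i j a => bare j i a.swap
  | deco i j F a => deco j i F.swap a.swap

theorem swap_swap (a : Spine) : a.swap.swap = a := by
  induction a <;> simp_all [swap, Motz.swap_swap]

theorem branches_swap (a : Spine) : a.swap.branches = a.branches := by
  induction a <;> simp_all [swap, branches, Motz.branches_swap]

theorem us_swap (a : Spine) : a.swap.us = a.zs := by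
  induction a <;> simp_all [swap, us, zs, Motz.us_swap]

theorem zs_swap (a : Spine) : a.swap.zs = a.us := by
  rw [← us_swap, swap_swap]

end Spine

namespace BinTree

/-- The number of inner nodes. -/
def size : BinTree → ℕ
  | nil => 0
  | node L R => L.size + R.size + 1

/-- The size of the first fan. -/
def deg : BinTree → ℕ
  | nil => 0
  | node L _ => L.deg + 1

/-- The list of the sizes of the fans. -/
def fans : BinTree → List ℕ
  | nil => []
  | node L R => (L.deg + 1) :: (L.fans.tail ++ R.fans)

/-- Append `j` leaves to the children of the root of the plane tree. -/
def grow : ℕ → BinTree → BinTree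
  | 0, T => T
  | j + 1, T => node (grow j T) nil

/-- Put a path of `i` unary nodes on top of the plane tree. -/
def stem : ℕ → BinTree → BinTree
  | 0, T => T
  | i + 1, T => node nil (stem i T)

theorem size_grow (j : ℕ) (T : BinTree) : (grow j T).size = j + T.size := by
  induction j with
  | zero => simp [grow]
  | succ j ih => simp only [grow, size, ih]; omega

theorem deg_grow (j : ℕ) (T : BinTree) : (grow j T).deg = j + T.deg := by
  induction j with
  | zero => simp [grow]
  | succ j ih => simp only [grow, deg, ih]; omega

theorem fans_grow_nil (j : ℕ) : (grow (j + 1) nil).fans = [j + 1] := by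
  induction j with
  | zero => simp [grow, fans, deg]
  | succ j ih => rw [grow, fans, ih, deg_grow]; simp [fans, deg]

theorem fans_grow_node (j : ℕ) (L R : BinTree) :
    (grow j (node L R)).fans = (j + L.deg + 1) :: (L.fans.tail ++ R.fans) := by
  induction j with
  | zero => simp [grow, fans]
  | succ j ih => rw [grow, fans, ih, deg_grow]; simp [fans, deg]; omega

theorem size_stem (i : ℕ) (T : BinTree) : (stem i T).size = i + T.size := by
  induction i with
  | zero => simp [stem]
  | succ i ih => simp only [stem, size, ih]; omega

theorem fans_stem (i : ℕ) (T : BinTree) :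
    (stem i T).fans = List.replicate i 1 ++ T.fans := by
  induction i with
  | zero => simp [stem]
  | succ i ih => simp [stem, fans, ih, List.replicate_succ, deg]

theorem fans_ne_nil {T : BinTree} (h : T ≠ nil) : T.fans ≠ [] := by
  cases T <;> simp_all [fans]

end BinTree

open BinTree

namespace Motz

/-- The two subtrees of the binary tree encoded by a Motzkin tree. -/
def pair : Motz → BinTree × BinTree
  | e => (nil, nil)
  | z F => (node F.pair.1 F.pair.2, nil)
  | u F => (F.pair.1, node nil F.pair.2)
  | b F G => (F.pair.1, node (node G.pair.1 G.pair.2) F.pair.2)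

/-- The nonempty binary tree encoded by a Motzkin tree. -/
def toTree (F : Motz) : BinTree := node F.pair.1 F.pair.2

theorem pair_injective : Function.Injective pair := by
  intro F
  induction F with
  | e => intro G h; cases G <;> simp_all [pair]
  | z F ih =>
    intro G h
    cases G with
    | z G => simp only [pair, Prod.mk.injEq, node.injEq, and_true] at h; rw [ih (Prod.ext h.1 h.2)]
    | _ => simp [pair] at h
  | u F ih =>
    intro G h
    cases G with
    | u G =>
      simp only [pair, Prod.mk.injEq, node.injEq, true_and] at h; rw [ih (Prod.ext h.1 h.2)]
    | _ => simp [pair] at h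
  | b F F' ih ih' =>
    intro G h
    cases G with
    | b G G' =>
      simp only [pair, Prod.mk.injEq, node.injEq] at h
      rw [ih (Prod.ext h.1 h.2.2), ih' (Prod.ext h.2.1.1 h.2.1.2)]
    | _ => simp [pair] at h

theorem toTree_injective : Function.Injective toTree := by
  intro F G h
  simp only [toTree, node.injEq] at h
  exact pair_injective (Prod.ext h.1 h.2)

theorem exists_pair_eq (L R : BinTree) : ∃ F : Motz, F.pair = (L, R) := by
  match L, R with
  | nil, nil => exact ⟨e, rfl⟩
  | node A B, nil =>
    obtain ⟨F, hF⟩ := exists_pair_eq A B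
    exact ⟨z F, by simp [pair, hF]⟩
  | L, node nil C =>
    obtain ⟨F, hF⟩ := exists_pair_eq L C
    exact ⟨u F, by simp [pair, hF]⟩
  | L, node (node A B) C =>
    obtain ⟨F, hF⟩ := exists_pair_eq L C
    obtain ⟨G, hG⟩ := exists_pair_eq A B
    exact ⟨b F G, by simp [pair, hF, hG]⟩
termination_by L.size + R.size
decreasing_by all_goals simp only [size]; omega

theorem exists_toTree_eq (L R : BinTree) : ∃ F : Motz, F.toTree = node L R := by
  obtain ⟨F, hF⟩ := exists_pair_eq L R
  exact ⟨F, by simp [toTree, hF]⟩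

theorem size_toTree (F : Motz) : F.toTree.size = 2 * F.branches + F.us + F.zs + 1 := by
  induction F <;> simp only [toTree, pair, size, branches, us, zs] at * <;> omega

theorem length_fans_toTree (F : Motz) :
    F.toTree.fans.tail.length = F.branches + F.us := by
  induction F <;>
    simp only [toTree, pair, fans, branches, us, List.tail_cons, List.length_append,
      List.length_cons, List.length_nil, List.tail_nil] at * <;> omega

theorem count_fans_toTree (F : Motz) : F.toTree.fans.tail.count 1 = F.us := by
  induction F <;>
    simp [toTree, pair, fans, us, deg] at * <;> omega

end Motz

namespace Spine

/-- The binary tree encoded by a spine. -/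
def toTree : Spine → BinTree
  | last i j => stem i (grow (j + 2) nil)
  | bare i j a => stem i (grow (j + 1) (node nil a.toTree))
  | deco i j F a => stem i (grow j (node F.toTree a.toTree))

theorem toTree_ne_nil (a : Spine) : a.toTree ≠ nil := by
  intro h
  have h' := congrArg size h
  cases a <;> simp [toTree, size_stem, size_grow, size] at h'

theorem size_toTree (a : Spine) : a.toTree.size = 2 * a.branches + a.us + a.zs := by
  induction a <;>
    simp only [toTree, size_stem, size_grow, size, branches, us, zs, Motz.size_toTree] at * <;>
    omega

theorem length_fans_toTree (a : Spine) : a.toTree.fans.length = a.branches + a.us := by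
  induction a with
  | last i j => simp [toTree, fans_stem, fans_grow_nil, branches, us]; omega
  | bare i j a ih => simp [toTree, fans_stem, fans_grow_node, branches, us, fans, ih]; omega
  | deco i j F a ih =>
    have := F.length_fans_toTree
    simp only [toTree, fans_stem, fans_grow_node, branches, us, List.length_append,
      List.length_replicate, List.length_cons, ih]
    omega

theorem count_fans_toTree (a : Spine) : a.toTree.fans.count 1 = a.us := by
  induction a with
  | last i j => simp [toTree, fans_stem, fans_grow_nil, us]
  | bare i j a ih =>
    simp [toTree, fans_stem, fans_grow_node, us, fans, ih, deg]
  | deco i j F a ih =>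
    have hd : F.toTree.deg ≠ 0 := by simp [Motz.toTree, deg]
    have := F.count_fans_toTree
    simp only [toTree, fans_stem, fans_grow_node, us, List.count_append, List.count_cons, ih,
      List.count_replicate_self]
    simp [hd]
    omega

theorem getLast_fans_toTree (a : Spine) (d : ℕ) : a.toTree.fans.getLastD d ≠ 1 := by
  induction a generalizing d with
  | last i j => simp [toTree, fans_stem, fans_grow_nil]
  | bare i j a ih =>
    have := fans_ne_nil a.toTree_ne_nil
    simp_all [toTree, fans_stem, fans_grow_node, fans, List.getLastD_eq_getLast?,
      List.getLast?_append, List.getLast?_cons]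
  | deco i j F a ih =>
    have := fans_ne_nil a.toTree_ne_nil
    simp_all [toTree, fans_stem, fans_grow_node, List.getLastD_eq_getLast?,
      List.getLast?_append, List.getLast?_cons]

end Spine

namespace BinTree

theorem exists_grow_eq {L R : BinTree} :
    (∃ j, node L R = grow (j + 1) nil) ∨
      ∃ j L' R', R' ≠ nil ∧ node L R = grow j (node L' R') := by
  induction L generalizing R with
  | nil =>
    cases R with
    | nil => exact .inl ⟨0, rfl⟩
    | node A B => exact .inr ⟨0, nil, node A B, by simp, rfl⟩
  | node A B ih _ =>
    cases R with
    | node C D => exact .inr ⟨0, _, node C D, by simp, rfl⟩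
    | nil =>
      rcases ih (R := B) with ⟨j, hj⟩ | ⟨j, L', R', h, hj⟩
      · exact .inl ⟨j + 1, by rw [hj]; rfl⟩
      · exact .inr ⟨j + 1, L', R', h, by rw [hj]; rfl⟩

/-- A binary tree whose root has an empty left but a nonempty right subtree, that is, a plane tree
with a unary root above another inner node. -/
def IsStem : BinTree → Prop
  | node nil (node _ _) => True
  | _ => False

theorem stem_inj {i i' : ℕ} {T T' : BinTree} (hT : ¬ T.IsStem) (hT' : ¬ T'.IsStem)
    (hn : T ≠ nil) (hn' : T' ≠ nil) (h : stem i T = stem i' T') : i = i' ∧ T = T' := by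
  have key : ∀ i (T : BinTree), T ≠ nil → (stem (i + 1) T).IsStem := by
    intro i T hT
    obtain ⟨A, B, hAB⟩ : ∃ A B, stem i T = node A B := by
      cases i with
      | zero => cases T <;> simp_all [stem]
      | succ i => exact ⟨_, _, rfl⟩
    simp [stem, hAB, IsStem]
  induction i generalizing i' with
  | zero =>
    cases i' with
    | zero => exact ⟨rfl, h⟩
    | succ i' => exact absurd ((show T = _ from h) ▸ key i' T' hn') hT
  | succ i ih =>
    cases i' with
    | zero => exact absurd ((show T' = _ from h.symm) ▸ key i T hn) hT'
    | succ i' =>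
      simp only [stem, node.injEq, true_and] at h
      exact ⟨by rw [(ih h).1], (ih h).2⟩

theorem grow_node_inj {j j' : ℕ} {L R L' R' : BinTree} (hR : R ≠ nil) (hR' : R' ≠ nil)
    (h : grow j (node L R) = grow j' (node L' R')) : j = j' ∧ L = L' ∧ R = R' := by
  induction j generalizing j' with
  | zero => cases j' <;> simp_all [grow]
  | succ j ih =>
    cases j' with
    | zero => simp only [grow, node.injEq] at h; exact absurd h.2.symm hR'
    | succ j' =>
      simp only [grow, node.injEq, and_true] at h
      exact ⟨by rw [(ih h).1], (ih h).2⟩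

theorem grow_nil_ne {j j' : ℕ} {L R : BinTree} (hR : R ≠ nil) :
    grow j nil ≠ grow j' (node L R) := by
  induction j generalizing j' with
  | zero => cases j' <;> simp [grow]
  | succ j ih =>
    cases j' with
    | zero => simp [grow, hR.symm]
    | succ j' => simpa [grow] using ih

end BinTree

namespace Spine

theorem exists_toTree_eq (T : BinTree) (hT : T ≠ nil) (hl : T.fans.getLastD 0 ≠ 1) :
    ∃ a : Spine, a.toTree = T := by
  have main : ∀ m, ∀ T : BinTree, T.size = m → T ≠ nil → T.fans.getLastD 0 ≠ 1 →
      ∃ a : Spine, a.toTree = T := by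
    intro m
    induction m using Nat.strong_induction_on with
    | _ m ih =>
      intro T hm hT hl
      obtain ⟨L, R, rfl⟩ : ∃ L R, T = node L R := by cases T <;> simp_all
      rcases exists_grow_eq (L := L) (R := R) with ⟨j, hj⟩ | ⟨j, L', R', hR, hj⟩
      · rw [hj, fans_grow_nil] at hl
        obtain ⟨j, rfl⟩ : ∃ k, j = k + 1 := ⟨j - 1, by simp at hl; omega⟩
        exact ⟨last 0 j, hj.symm⟩
      · have hs : R'.size < m := by rw [← hm, hj, size_grow, size]; omega
        have hlR : R'.fans.getLastD 0 ≠ 1 := by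
          have := fans_ne_nil hR
          simpa [hj, fans_grow_node, List.getLastD_eq_getLast?, List.getLast?_append,
            List.getLast?_cons, this, List.getLast?_eq_getLast_of_ne_nil this] using hl
        obtain ⟨a, rfl⟩ := ih _ hs R' rfl hR hlR
        rw [hj]
        cases L' with
        | node A B =>
          obtain ⟨F, hF⟩ := Motz.exists_toTree_eq A B
          exact ⟨deco 0 j F a, by simp [toTree, hF, stem]⟩
        | nil =>
          cases j with
          | succ j => exact ⟨bare 0 j a, rfl⟩
          | zero =>
            cases a with
            | last i k => exact ⟨last (i + 1) k, rfl⟩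
            | bare i k a => exact ⟨bare (i + 1) k a, rfl⟩
            | deco i k F a => exact ⟨deco (i + 1) k F a, rfl⟩
  exact main _ T rfl hT hl

theorem toTree_injective : Function.Injective toTree := by
  have s1 (j) (T : BinTree) : ¬ (grow (j + 1) T).IsStem := by simp [grow, IsStem]
  have n1 (j) (T : BinTree) : grow (j + 1) T ≠ nil := by simp [grow]
  have s2 (j) (F : Motz) (T : BinTree) : ¬ (grow j (node F.toTree T)).IsStem := by
    cases j <;> simp [grow, IsStem, Motz.toTree]
  have n2 (j) (L R : BinTree) : grow j (node L R) ≠ nil := by cases j <;> simp [grow]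
  intro a
  induction a with
  | last i j =>
    intro c h
    cases c with
    | last i' j' =>
      obtain ⟨rfl, h'⟩ := stem_inj (s1 _ _) (s1 _ _) (n1 _ _) (n1 _ _) h
      have := congrArg size h'
      simp only [size_grow] at this
      rw [show j = j' by omega]
    | bare i' j' c =>
      exact absurd (stem_inj (s1 _ _) (s1 _ _) (n1 _ _) (n1 _ _) h).2
        (grow_nil_ne c.toTree_ne_nil)
    | deco i' j' F c =>
      exact absurd (stem_inj (s1 _ _) (s2 _ _ _) (n1 _ _) (n2 _ _ _) h).2
        (grow_nil_ne c.toTree_ne_nil)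
  | bare i j a ih =>
    intro c h
    cases c with
    | last i' j' =>
      exact absurd (stem_inj (s1 _ _) (s1 _ _) (n1 _ _) (n1 _ _) h).2.symm
        (grow_nil_ne a.toTree_ne_nil)
    | bare i' j' c =>
      obtain ⟨rfl, h'⟩ := stem_inj (s1 _ _) (s1 _ _) (n1 _ _) (n1 _ _) h
      obtain ⟨hj, -, h''⟩ := grow_node_inj a.toTree_ne_nil c.toTree_ne_nil h'
      rw [ih h'', Nat.succ_injective hj]
    | deco i' j' F c =>
      obtain ⟨-, h, -⟩ := grow_node_inj a.toTree_ne_nil c.toTree_ne_nil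
        (stem_inj (s1 _ _) (s2 _ _ _) (n1 _ _) (n2 _ _ _) h).2
      simp [Motz.toTree] at h
  | deco i j F a ih =>
    intro c h
    cases c with
    | last i' j' =>
      exact absurd (stem_inj (s2 _ _ _) (s1 _ _) (n2 _ _ _) (n1 _ _) h).2.symm
        (grow_nil_ne a.toTree_ne_nil)
    | bare i' j' c =>
      obtain ⟨-, h, -⟩ := grow_node_inj a.toTree_ne_nil c.toTree_ne_nil
        (stem_inj (s2 _ _ _) (s1 _ _) (n2 _ _ _) (n1 _ _) h).2
      simp [Motz.toTree] at h
    | deco i' j' G c =>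
      obtain ⟨rfl, h'⟩ := stem_inj (s2 _ _ _) (s2 _ _ _) (n2 _ _ _) (n2 _ _ _) h
      obtain ⟨rfl, hF, h''⟩ := grow_node_inj a.toTree_ne_nil c.toTree_ne_nil h'
      rw [ih h'', Motz.toTree_injective hF]

end Spine

/-! ## Triangulations as binary trees -/

namespace BinTree

/-- The diagonals, including the base edge, of the triangulation of the polygon on the vertices
`p, …, p + T.size + 1` encoded by a binary tree `T`. -/
def chords : BinTree → ℕ → Finset (ℕ × ℕ)
  | nil, _ => ∅
  | node L R, p =>
    insert (p, p + L.size + R.size + 2) (chords L p ∪ chords R (p + L.size + 1))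

theorem mem_chords_node {L R : BinTree} {p a b : ℕ} :
    (a, b) ∈ chords (node L R) p ↔ (a = p ∧ b = p + L.size + R.size + 2) ∨
      (a, b) ∈ chords L p ∨ (a, b) ∈ chords R (p + L.size + 1) := by
  simp [chords]

theorem bounds_of_mem_chords {T : BinTree} {p a b : ℕ} (h : (a, b) ∈ chords T p) :
    p ≤ a ∧ a + 1 < b ∧ b ≤ p + T.size + 1 := by
  induction T generalizing p with
  | nil => simp [chords] at h
  | node L R ihL ihR =>
    simp only [size]
    rcases mem_chords_node.1 h with h | h | h
    · omega
    · have := ihL h; omega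
    · have := ihR h; omega

theorem base_mem_chords {T : BinTree} {p r : ℕ} (hr : r = p + T.size + 1) (h : p + 1 < r) :
    (p, r) ∈ chords T p := by
  cases T with
  | nil => simp [size] at hr; omega
  | node L R => exact mem_chords_node.2 (.inl ⟨rfl, by simp only [size] at hr; omega⟩)

theorem not_crosses_of_mem_chords {T : BinTree} {p a b c d : ℕ} (h : (a, b) ∈ chords T p)
    (h' : (c, d) ∈ chords T p) : ¬ Crosses (a, b) (c, d) := by
  induction T generalizing p with
  | nil => simp [chords] at h
  | node L R ihL ihR =>
    have B := bounds_of_mem_chords h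
    have B' := bounds_of_mem_chords h'
    simp only [size] at B B'
    rcases mem_chords_node.1 h with h | h | h <;> rcases mem_chords_node.1 h' with h' | h' | h'
    · simp only [Crosses]; omega
    · simp only [Crosses]; omega
    · simp only [Crosses]; omega
    · simp only [Crosses]; omega
    · exact ihL h h'
    · have := bounds_of_mem_chords h
      have := bounds_of_mem_chords h'
      simp only [Crosses]; omega
    · simp only [Crosses]; omega
    · have := bounds_of_mem_chords h
      have := bounds_of_mem_chords h'
      simp only [Crosses]; omega
    · exact ihR h h'

theorem mem_chords_of_not_crosses {T : BinTree} {p a b : ℕ} (ha : p ≤ a) (hab : a + 1 < b)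
    (hb : b ≤ p + T.size + 1) (h : ∀ d ∈ chords T p, ¬ Crosses (a, b) d) :
    (a, b) ∈ chords T p := by
  induction T generalizing p with
  | nil => simp only [size] at hb; omega
  | node L R ihL ihR =>
    simp only [size] at hb
    rw [mem_chords_node]
    by_cases hbq : b ≤ p + L.size + 1
    · exact .inr (.inl (ihL ha hbq fun d hd => h d (by simp [chords, hd])))
    by_cases haq : p + L.size + 1 ≤ a
    · exact .inr (.inr (ihR haq (by omega) fun d hd => h d (by simp [chords, hd])))
    refine .inl ⟨?_, ?_⟩
    · by_contra hne
      refine h (p, p + L.size + 1) (mem_chords_node.2 (.inr (.inl ?_))) ?_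
      · exact base_mem_chords rfl (by omega)
      · simp only [Crosses]; omega
    · by_contra hne
      refine h (p + L.size + 1, p + L.size + 1 + R.size + 1)
        (mem_chords_node.2 (.inr (.inr ?_))) ?_
      · exact base_mem_chords rfl (by omega)
      · simp only [Crosses]; omega

theorem eq_of_mem_chords_iff {T T' : BinTree} {p : ℕ} (hs : T.size = T'.size)
    (h : ∀ a b, (a, b) ∈ chords T p ↔ (a, b) ∈ chords T' p) : T = T' := by
  induction T generalizing T' p with
  | nil => cases T' with
    | nil => rfl
    | node => simp [size] at hs
  | node L R ihL ihR =>
    cases T' with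
    | nil => simp [size] at hs
    | node L' R' =>
      simp only [size] at hs
      have hL : L.size = L'.size := by
        rcases lt_trichotomy L.size L'.size with hlt | heq | hlt
        · have h1 : (p, p + L'.size + 1) ∈ chords (node L R) p :=
            (h _ _).2 (mem_chords_node.2 (.inr (.inl (base_mem_chords rfl (by omega)))))
          have h2 : (p + L.size + 1, p + L.size + 1 + R.size + 1) ∈ chords (node L R) p :=
            mem_chords_node.2 (.inr (.inr (base_mem_chords rfl (by omega))))
          have := not_crosses_of_mem_chords h1 h2
          simp only [Crosses] at this; omega
        · exact heq
        · have h1 : (p, p + L.size + 1) ∈ chords (node L' R') p :=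
            (h _ _).1 (mem_chords_node.2 (.inr (.inl (base_mem_chords rfl (by omega)))))
          have h2 : (p + L'.size + 1, p + L'.size + 1 + R'.size + 1) ∈ chords (node L' R') p :=
            mem_chords_node.2 (.inr (.inr (base_mem_chords rfl (by omega))))
          have := not_crosses_of_mem_chords h1 h2
          simp only [Crosses] at this; omega
      have hR : R.size = R'.size := by omega
      congr 1
      · refine ihL (p := p) hL fun a b => ⟨fun hab => ?_, fun hab => ?_⟩
        · have B := bounds_of_mem_chords hab
          rcases mem_chords_node.1 ((h a b).1 (mem_chords_node.2 (.inr (.inl hab)))) with k | k | k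
          · omega
          · exact k
          · have := bounds_of_mem_chords k; omega
        · have B := bounds_of_mem_chords hab
          rcases mem_chords_node.1 ((h a b).2 (mem_chords_node.2 (.inr (.inl hab)))) with k | k | k
          · omega
          · exact k
          · have := bounds_of_mem_chords k; omega
      · refine ihR (p := p + L.size + 1) hR fun a b => ⟨fun hab => ?_, fun hab => ?_⟩
        · have B := bounds_of_mem_chords hab
          rcases mem_chords_node.1 ((h a b).1 (mem_chords_node.2 (.inr (.inr hab)))) with k | k | k
          · omega
          · have := bounds_of_mem_chords k; omega
          · rwa [hL]
        · have B := bounds_of_mem_chords hab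
          rw [hL] at hab
          rcases mem_chords_node.1 ((h a b).2 (mem_chords_node.2 (.inr (.inr hab)))) with k | k | k
          · omega
          · have := bounds_of_mem_chords k; omega
          · exact k

/-- Every interval of vertices whose base edge lies in a maximal noncrossing set is triangulated
by the diagonals of some binary tree. -/
theorem exists_chords_eq {n : ℕ} {S : Finset (ℕ × ℕ)}
    (hnc : ∀ c ∈ S, ∀ d ∈ S, ¬ Crosses c d)
    (hmax : ∀ a b, 1 ≤ a → a + 1 < b → b ≤ n → (∀ d ∈ S, ¬ Crosses (a, b) d) → (a, b) ∈ S)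
    {p r : ℕ} (hp : 1 ≤ p) (hpr : p < r) (hr : r ≤ n) (hbase : p + 1 = r ∨ (p, r) ∈ S) :
    ∃ T : BinTree, p + T.size + 1 = r ∧
      ∀ a b, p ≤ a → a + 1 < b → b ≤ r → ((a, b) ∈ S ↔ (a, b) ∈ chords T p) := by
  have main : ∀ m p r, r - p = m → 1 ≤ p → p < r → r ≤ n → (p + 1 = r ∨ (p, r) ∈ S) →
      ∃ T : BinTree, p + T.size + 1 = r ∧
        ∀ a b, p ≤ a → a + 1 < b → b ≤ r → ((a, b) ∈ S ↔ (a, b) ∈ chords T p) := by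
    intro m
    induction m using Nat.strong_induction_on with
    | _ m ih =>
      intro p r hm hp hpr hr hbase
      by_cases h1 : p + 1 = r
      · exact ⟨nil, by simp [size, h1], by omega⟩
      have htop : (p, r) ∈ S := hbase.resolve_left h1
      classical
      let P : ℕ → Prop := fun q => q = p + 1 ∨ (p < q ∧ (p, q) ∈ S)
      have hP : P (Nat.findGreatest P (r - 1)) :=
        Nat.findGreatest_spec (P := P) (m := p + 1) (by omega) (.inl rfl)
      have hge : p + 1 ≤ Nat.findGreatest P (r - 1) :=
        Nat.le_findGreatest (P := P) (by omega) (.inl rfl)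
      have hle : Nat.findGreatest P (r - 1) ≤ r - 1 := Nat.findGreatest_le _
      have hgr : ∀ k, k < r → P k → k ≤ Nat.findGreatest P (r - 1) := fun k hk hPk =>
        Nat.le_findGreatest (by omega) hPk
      generalize Nat.findGreatest P (r - 1) = q at hP hge hle hgr
      have hleft : p + 1 = q ∨ (p, q) ∈ S := hP.imp Eq.symm And.right
      have hright : q + 1 = r ∨ (q, r) ∈ S := by
        by_cases hq : q + 1 = r
        · exact .inl hq
        refine .inr (hmax q r (by omega) (by omega) hr ?_)
        rintro ⟨a, b⟩ hd hc
        have k1 := hnc _ htop _ hd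
        have k2 : (p, q) ∈ S → ¬ Crosses (p, q) (a, b) := fun k => hnc _ k _ hd
        have k3 : a = p → p < b → b < r → b ≤ q := fun e1 e2 e3 =>
          hgr b e3 (.inr ⟨e2, e1 ▸ hd⟩)
        simp only [Crosses] at hc k1 k2
        rcases hleft with hl | hl
        · omega
        · have := k2 hl; omega
      obtain ⟨L, hLs, hL⟩ := ih (q - p) (by omega) p q rfl hp (by omega) (by omega) hleft
      obtain ⟨R, hRs, hR⟩ := ih (r - q) (by omega) q r rfl (by omega) (by omega) hr hright
      refine ⟨node L R, by simp only [size]; omega, fun a b ha hab hb => ?_⟩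
      rw [mem_chords_node, hLs, show p + L.size + R.size + 2 = r by omega]
      by_cases hbq : b ≤ q
      · rw [hL a b ha hab hbq]
        refine ⟨fun k => .inr (.inl k), ?_⟩
        rintro (k | k | k)
        · omega
        · exact k
        · have := bounds_of_mem_chords k; omega
      by_cases haq : q ≤ a
      · rw [hR a b haq hab hb]
        refine ⟨fun k => .inr (.inr k), ?_⟩
        rintro (k | k | k)
        · omega
        · have := bounds_of_mem_chords k; omega
        · exact k
      constructor
      · intro hd
        left
        have k2 : (p, q) ∈ S → ¬ Crosses (p, q) (a, b) := fun k => hnc _ k _ hd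
        have k3 : a = p → p < b → b < r → b ≤ q := fun e1 e2 e3 =>
          hgr b e3 (.inr ⟨e2, e1 ▸ hd⟩)
        simp only [Crosses] at k2
        rcases hleft with hl | hl
        · omega
        · have := k2 hl; omega
      · rintro (k | k | k)
        · rw [k.1, k.2]; exact htop
        · have := bounds_of_mem_chords k; omega
        · have := bounds_of_mem_chords k; omega
  exact main _ p r rfl hp hpr hr hbase

/-! ### The fans of an encoded triangulation -/

/-- The vertices other than `p` of the fan at `p`, in increasing order. -/
def link : BinTree → ℕ → List ℕ
  | nil, p => [p + 1]
  | node L R, p => link L p ++ [p + L.size + R.size + 2]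

theorem exists_link_eq_cons (T : BinTree) (p : ℕ) : ∃ l, link T p = (p + 1) :: l := by
  induction T with
  | nil => exact ⟨[], rfl⟩
  | node L R ihL _ => obtain ⟨l, hl⟩ := ihL; exact ⟨_, by rw [link, hl]; rfl⟩

theorem length_link (T : BinTree) (p : ℕ) : (link T p).length = T.deg + 1 := by
  induction T <;> simp_all [link, deg]

theorem exists_link_eq_concat (T : BinTree) (p : ℕ) : ∃ l, link T p = l ++ [p + T.size + 1] := by
  cases T with
  | nil => exact ⟨[], rfl⟩
  | node L R => exact ⟨link L p, by simp [link, size]; omega⟩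

theorem mem_link {T : BinTree} {p x : ℕ} : x ∈ link T p ↔ x = p + 1 ∨ (p, x) ∈ chords T p := by
  induction T with
  | nil => simp [link, chords]
  | node L R ihL _ =>
    have : (p, x) ∉ chords R (p + L.size + 1) := fun h => by
      have := bounds_of_mem_chords h; omega
    simp only [link, List.mem_append, ihL, mem_chords_node, this, List.mem_singleton]
    tauto

theorem sortedLT_link (T : BinTree) (p : ℕ) : (link T p).Pairwise (· < ·) := by
  induction T with
  | nil => simp [link]
  | node L R ihL _ =>
    rw [link, List.pairwise_append]
    refine ⟨ihL, by simp, fun x hx y hy => ?_⟩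
    rw [List.mem_singleton] at hy
    rcases mem_link.1 hx with h | h
    · omega
    · have := bounds_of_mem_chords h; omega

theorem flatMap_zip_tail_concat {α β : Type*} (f : α × α → List β) (l : List α) (a b : α) :
    ((l ++ [a] ++ [b]).zip (l ++ [a] ++ [b]).tail).flatMap f =
      ((l ++ [a]).zip (l ++ [a]).tail).flatMap f ++ f (a, b) := by
  induction l with
  | nil => simp
  | cons x l ih => cases l <;> simp_all

/-- The condition that `S` restricts to the diagonals of `T` on the vertices
`p, …, p + T.size + 1`. -/
def Agrees (S : Finset (ℕ × ℕ)) (T : BinTree) (p : ℕ) : Prop :=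
  ∀ a b, p ≤ a → a + 1 < b → b ≤ p + T.size + 1 → (a, b) ≠ (p, p + T.size + 1) →
    ((a, b) ∈ S ↔ (a, b) ∈ chords T p)

theorem Agrees.left {S : Finset (ℕ × ℕ)} {L R : BinTree} {p a b : ℕ} (h : Agrees S (node L R) p)
    (ha : p ≤ a) (hab : a + 1 < b) (hb : b ≤ p + L.size + 1) :
    (a, b) ∈ S ↔ (a, b) ∈ chords L p := by
  rw [h a b ha hab (by simp only [size]; omega)
    (by simp only [size, ne_eq, Prod.mk.injEq]; omega), mem_chords_node]
  refine ⟨?_, fun k => .inr (.inl k)⟩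
  rintro (k | k | k)
  · omega
  · exact k
  · have := bounds_of_mem_chords k; omega

theorem Agrees.right {S : Finset (ℕ × ℕ)} {L R : BinTree} {p a b : ℕ}
    (h : Agrees S (node L R) p) (ha : p + L.size + 1 ≤ a) (hab : a + 1 < b)
    (hb : b ≤ p + L.size + R.size + 2) :
    (a, b) ∈ S ↔ (a, b) ∈ chords R (p + L.size + 1) := by
  rw [h a b (by omega) hab (by simp only [size]; omega)
    (by simp only [size, ne_eq, Prod.mk.injEq]; omega), mem_chords_node]
  refine ⟨?_, fun k => .inr (.inr k)⟩
  rintro (k | k | k)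
  · omega
  · have := bounds_of_mem_chords k; omega
  · exact k

theorem sort_filter_eq_tail_link {S : Finset (ℕ × ℕ)} {L R : BinTree} {p : ℕ}
    (h : Agrees S (node L R) p) :
    ((S.filter fun c => c.1 = p ∧ p + 1 < c.2 ∧ c.2 < p + (node L R).size + 1).image
      Prod.snd).sort (· ≤ ·) = (link L p).tail := by
  obtain ⟨l, hl⟩ := exists_link_eq_cons L p
  have hsort := sortedLT_link L p
  have hmem : ∀ x, x ∈ link L p ↔ _ := fun x => mem_link
  rw [hl] at hsort hmem ⊢
  rw [List.pairwise_cons] at hsort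
  have key : (S.filter fun c => c.1 = p ∧ p + 1 < c.2 ∧ c.2 < p + (node L R).size + 1).image
      Prod.snd = l.toFinset := by
    ext x
    simp only [Finset.mem_image, Finset.mem_filter, List.mem_toFinset, Prod.exists,
      exists_eq_right]
    constructor
    · rintro ⟨a, hS, rfl, hx, hx'⟩
      have hL : (a, x) ∈ chords L a := by
        rw [h a x le_rfl hx (by omega) (by simp; omega), mem_chords_node] at hS
        rcases hS with k | k | k
        · simp only [size] at hx'; omega
        · exact k
        · have := bounds_of_mem_chords k; omega
      exact ((List.mem_cons.1 ((hmem x).2 (.inr hL))).resolve_left (by omega))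
    · intro hx
      have hlt := hsort.1 x hx
      have hL := ((hmem x).1 (List.mem_cons_of_mem _ hx)).resolve_left (by omega)
      have B := bounds_of_mem_chords hL
      exact ⟨p, (h.left le_rfl B.2.1 B.2.2).2 hL, rfl, hlt, by simp only [size]; omega⟩
  rw [key, List.tail_cons]
  exact (List.toFinset_sort (· ≤ ·) (hsort.2.imp ne_of_lt)).2 (hsort.2.imp le_of_lt)

theorem map_snd_fanListAux {S : Finset (ℕ × ℕ)} (T : BinTree) {fuel p : ℕ}
    (hf : T.size + 1 ≤ fuel) (h : Agrees S T p) :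
    (fanListAux S fuel p (p + T.size + 1)).map Prod.snd = T.fans := by
  suffices H : ∀ (T : BinTree) (p : ℕ), Agrees S T p →
      (∀ fuel, T.size + 1 ≤ fuel →
        (fanListAux S fuel p (p + T.size + 1)).map Prod.snd = T.fans) ∧
      (∀ fuel, T.size ≤ fuel →
        ((link T p).zip (link T p).tail).flatMap
          (fun q => (fanListAux S fuel q.1 q.2).map Prod.snd) = T.fans.tail) from
    (H T p h).1 fuel hf
  intro T
  induction T with
  | nil =>
    intro p _
    refine ⟨fun fuel hf => ?_, fun fuel _ => by simp [link, fans]⟩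
    obtain ⟨k, rfl⟩ : ∃ k, fuel = k + 1 := ⟨fuel - 1, by simp only [size] at hf; omega⟩
    simp [fanListAux, size, fans]
  | node L R ihL ihR =>
    intro p h
    have key : ∀ fuel, (node L R).size ≤ fuel →
        ((link (node L R) p).zip (link (node L R) p).tail).flatMap
          (fun q => (fanListAux S fuel q.1 q.2).map Prod.snd) = (node L R).fans.tail := by
      intro fuel hf
      simp only [size] at hf
      obtain ⟨l, hl⟩ := exists_link_eq_concat L p
      have h1 := (ihL p fun a b ha hab hb _ => h.left ha hab hb).2 fuel (by omega)
      have h2 := (ihR (p + L.size + 1) fun a b ha hab hb _ =>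
        h.right ha hab (by omega)).1 fuel (by omega)
      rw [hl] at h1
      rw [link, hl, flatMap_zip_tail_concat, h1,
        show p + L.size + R.size + 2 = p + L.size + 1 + R.size + 1 by omega, h2]
      simp [fans]
    refine ⟨fun fuel hf => ?_, key⟩
    obtain ⟨k, rfl⟩ : ∃ k, fuel = k + 1 := ⟨fuel - 1, by omega⟩
    rw [fanListAux, if_neg (by simp only [size]; omega)]
    simp only [sort_filter_eq_tail_link h]
    obtain ⟨l, hl⟩ := exists_link_eq_cons L p
    have hlink : (p + 1) :: ((link L p).tail ++ [p + (node L R).size + 1]) =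
        link (node L R) p := by
      rw [link, hl, size, show p + (L.size + R.size + 1) + 1 = p + L.size + R.size + 2 by omega]
      simp
    have hlen := length_link L p
    rw [hlink, List.map_cons, List.map_flatMap, key k (by omega)]
    simp only [fans, List.tail_cons, List.length_tail, hlen]
    simp

/-- The triangulation of the polygon on the vertices `1, …, n` encoded by a binary tree with
`n - 2` inner nodes. -/
def triangulation (n : ℕ) (T : BinTree) : Finset (ℕ × ℕ) := (chords T 1).erase (1, n)

theorem isTriangulation_triangulation {n : ℕ} {T : BinTree} (hn : T.size + 2 = n) :
    IsTriangulation n (triangulation n T) := by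
  refine ⟨⟨?_, ?_⟩, ?_⟩
  · rintro ⟨a, b⟩ h
    simp only [triangulation, Finset.mem_erase, ne_eq, Prod.mk.injEq] at h
    have B := bounds_of_mem_chords h.2
    exact ⟨B.1, B.2.1, by simp only; omega, h.1⟩
  · rintro ⟨a, b⟩ h ⟨c, d⟩ h' -
    exact not_crosses_of_mem_chords (Finset.mem_of_mem_erase h) (Finset.mem_of_mem_erase h')
  · rintro ⟨a, b⟩ ⟨h1, h2, h3, h4⟩ h
    simp only at h1 h2 h3 h4
    refine Finset.mem_erase.2 ⟨by simpa using h4,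
      mem_chords_of_not_crosses h1 h2 (by omega) fun d hd => ?_⟩
    by_cases hd1 : d = (1, n)
    · subst hd1; simp only [Crosses]; omega
    · exact h d (Finset.mem_erase.2 ⟨hd1, hd⟩)

theorem map_snd_fanList_triangulation {n : ℕ} {T : BinTree} (hn : T.size + 2 = n) :
    (fanList (triangulation n T) 1 n).map Prod.snd = T.fans := by
  have := map_snd_fanListAux (S := triangulation n T) T (fuel := n - 1) (p := 1) (by omega)
    (fun a b _ _ _ hne => by
      rw [triangulation, Finset.mem_erase, and_iff_right]
      rwa [show 1 + T.size + 1 = n by omega] at hne)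
  rwa [show 1 + T.size + 1 = n by omega] at this

theorem triangulation_inj {n : ℕ} {T T' : BinTree} (hn : T.size + 2 = n) (hn' : T'.size + 2 = n)
    (h : triangulation n T = triangulation n T') : T = T' := by
  by_cases h3 : n = 2
  · have h0 : T.size = 0 := by omega
    have h0' : T'.size = 0 := by omega
    cases T <;> cases T' <;> simp_all [size]
  refine eq_of_mem_chords_iff (p := 1) (by omega) fun a b => ?_
  have hb : (1, n) ∈ chords T 1 := base_mem_chords (by omega) (by omega)
  have hb' : (1, n) ∈ chords T' 1 := base_mem_chords (by omega) (by omega)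
  rw [← Finset.insert_erase hb, ← Finset.insert_erase hb']
  exact iff_of_eq (congrArg (fun X => (a, b) ∈ insert (1, n) X) h)

theorem exists_triangulation_eq {n : ℕ} (hn : 2 ≤ n) {S : Finset (ℕ × ℕ)}
    (hS : IsTriangulation n S) : ∃ T : BinTree, T.size + 2 = n ∧ triangulation n T = S := by
  obtain ⟨⟨hc, hnc⟩, hmax⟩ := hS
  obtain ⟨T, hs, hT⟩ := exists_chords_eq (n := n) (S := insert (1, n) S) (p := 1) (r := n)
    (by
      rintro ⟨a, b⟩ h ⟨c, d⟩ h'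
      rw [Finset.mem_insert, Prod.mk.injEq] at h h'
      rcases h with h | h <;> rcases h' with h' | h'
      · simp only [Crosses]; omega
      · have := hc _ h'
        simp only [Crosses, IsChord] at *; omega
      · have := hc _ h
        simp only [Crosses, IsChord] at *; omega
      · by_cases he : (a, b) = (c, d)
        · rw [Prod.mk.injEq] at he
          simp only [Crosses]; omega
        · exact hnc _ h _ h' he)
    (by
      intro a b ha hab hb h
      by_cases he : (a, b) = (1, n)
      · simp [he]
      · refine Finset.mem_insert_of_mem (hmax _ ⟨ha, hab, hb, by simpa using he⟩ fun d hd => ?_)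
        exact h d (Finset.mem_insert_of_mem hd))
    le_rfl (by omega) le_rfl (.inr (Finset.mem_insert_self _ _))
  refine ⟨T, by omega, ?_⟩
  ext ⟨a, b⟩
  rw [triangulation, Finset.mem_erase]
  constructor
  · rintro ⟨hne, h⟩
    have B := bounds_of_mem_chords h
    exact (Finset.mem_insert.1 ((hT a b B.1 B.2.1 (by omega)).2 h)).resolve_left hne
  · intro h
    obtain ⟨h1, h2, h3, h4⟩ := hc _ h
    exact ⟨by simpa using h4, (hT a b h1 h2 h3).1 (Finset.mem_insert_of_mem h)⟩

theorem triangulation_mem_triSet_iff {n t s : ℕ} {T : BinTree} (hn : T.size + 2 = n) :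
    triangulation n T ∈ TriSet n t s ↔
      T.fans.length = t + s ∧ T.fans.count 1 = s ∧ T.fans.getLastD 0 ≠ 1 := by
  have hfans := map_snd_fanList_triangulation hn
  have h1 : (fanList (triangulation n T) 1 n).length = T.fans.length := by
    rw [← hfans, List.length_map]
  have h2 : ((fanList (triangulation n T) 1 n).filter fun fan => decide (fan.2 = 1)).length =
      T.fans.count 1 := by
    rw [← hfans, List.count, List.countP_map, List.countP_eq_length_filter]
    rfl
  have h3 : ((fanList (triangulation n T) 1 n).getLastD (0, 0)).2 = T.fans.getLastD 0 := by
    rw [← hfans, List.getLastD_eq_getLast?, List.getLastD_eq_getLast?, List.getLast?_map]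
    cases (fanList (triangulation n T) 1 n).getLast? <;> rfl
  simp only [TriSet, Set.mem_ofPred_eq, h1, h2, h3, isTriangulation_triangulation hn, true_and]

end BinTree

/-- Triangulations with `t` nonsingular and `s` singular fans, the last one nonsingular, are
encoded by spines. -/
theorem nonempty_spine_equiv_triSet {n t s s' : ℕ} (ht : 1 ≤ t) (hn : n = 2 * t + s + s' + 2) :
    Nonempty ({a : Spine // a.branches = t ∧ a.us = s ∧ a.zs = s'} ≃ ↥(TriSet n t s)) := by
  have hsize : ∀ a : {a : Spine // a.branches = t ∧ a.us = s ∧ a.zs = s'},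
      a.1.toTree.size + 2 = n := by
    rintro ⟨a, h1, h2, h3⟩
    rw [a.size_toTree, h1, h2, h3, hn]
  refine ⟨Equiv.ofBijective (fun a => ⟨triangulation n a.1.toTree,
    (triangulation_mem_triSet_iff (hsize a)).2 ⟨?_, ?_, a.1.getLast_fans_toTree 0⟩⟩) ⟨?_, ?_⟩⟩
  · rw [a.1.length_fans_toTree, a.2.1, a.2.2.1]
  · rw [a.1.count_fans_toTree, a.2.2.1]
  · intro a c h
    exact Subtype.ext (Spine.toTree_injective
      (triangulation_inj (hsize a) (hsize c) (congrArg Subtype.val h)))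
  · rintro ⟨S, hS⟩
    obtain ⟨T, hT, rfl⟩ := exists_triangulation_eq (by omega) hS.1
    obtain ⟨h1, h2, h3⟩ := (triangulation_mem_triSet_iff hT).1 hS
    obtain ⟨a, rfl⟩ := Spine.exists_toTree_eq T
      (by rintro rfl; simp only [fans, List.length_nil] at h1; omega) h3
    rw [a.length_fans_toTree] at h1
    rw [a.count_fans_toTree] at h2
    rw [a.size_toTree] at hT
    exact ⟨⟨a, by omega, h2, by omega⟩, rfl⟩

/-- For all `n`, `t ≥ 1` and `s` with `n ≥ s + 2t + 2`, `Tri(n,t,s)` and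
`Tri(n,t,n-s-2t-2)` have the same cardinality. -/
theorem tri_symm (n t s : ℕ) (ht : 1 ≤ t) (hn : s + 2 * t + 2 ≤ n) :
    Nonempty (↥(TriSet n t s) ≃ ↥(TriSet n t (n - s - 2 * t - 2))) := by
  obtain ⟨e⟩ := nonempty_spine_equiv_triSet (n := n) (s := s) (s' := n - s - 2 * t - 2) ht (by omega)
  obtain ⟨e'⟩ := nonempty_spine_equiv_triSet (n := n) (s := n - s - 2 * t - 2) (s' := s) ht (by omega)
  have hinv : Function.Involutive Spine.swap := Spine.swap_swap
  refine ⟨e.symm.trans ((hinv.toPerm.subtypeEquiv fun a => ?_).trans e')⟩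
  change _ ↔ a.swap.branches = t ∧ a.swap.us = _ ∧ a.swap.zs = _
  rw [Spine.branches_swap, Spine.us_swap, Spine.zs_swap, and_comm (a := a.us = s)]
end

section
/- The fan decomposition uniquely determines a triangulation: if T and T' are triangulations of the convex n-gon with vertices labeled 1,…,n counterclockwise and (F(T), δ(T)) = (F(T'), δ(T')) (the two sequences of fans have the same lengths with corresponding fans having the same number of triangles, and the two sequences of origin-label differences are equal), then T = T'. -/
theorem mem_zip_tail_of_pairwise_lt {L : List ℕ} (hL : L.Pairwise (· < ·)) {q : ℕ × ℕ}
    (hq : q ∈ L.zip L.tail) :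
    q.1 ∈ L ∧ q.2 ∈ L ∧ q.1 < q.2 ∧ ∀ x ∈ L, x ≤ q.1 ∨ q.2 ≤ x := by
  induction L with
  | nil => simp at hq
  | cons a l ih =>
    cases l with
    | nil => simp at hq
    | cons b l =>
      rw [List.pairwise_cons] at hL
      simp only [List.tail_cons, List.zip_cons_cons, List.mem_cons] at hq
      rcases hq with rfl | hq
      · refine ⟨by simp, by simp, hL.1 b (by simp), fun x hx => ?_⟩
        rcases List.mem_cons.1 hx with rfl | hx
        · exact Or.inl le_rfl
        · rcases List.mem_cons.1 hx with rfl | hx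
          · exact Or.inr le_rfl
          · exact Or.inr (List.rel_of_pairwise_cons hL.2 hx).le
      · obtain ⟨h1, h2, h3, h4⟩ := ih hL.2 (by simpa using hq)
        refine ⟨List.mem_cons_of_mem _ h1, List.mem_cons_of_mem _ h2, h3, fun x hx => ?_⟩
        rcases List.mem_cons.1 hx with rfl | hx
        · exact Or.inl (hL.1 _ h1).le
        · exact h4 x hx

/-- Cutting an interval of naturals along an increasing list of breakpoints. -/
theorem flatMap_zip_tail_eq_flatMap_range' {α : Type*} (f : ℕ × ℕ → List α) (g : ℕ → List α)
    (z : ℕ) (l : List ℕ) (a : ℕ) (hL : (a :: (l ++ [z])).Pairwise (· < ·))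
    (hf : ∀ q ∈ (a :: (l ++ [z])).zip (l ++ [z]),
      f q = (List.range' q.1 (q.2 - q.1)).flatMap g) :
    ((a :: (l ++ [z])).zip (l ++ [z])).flatMap f = (List.range' a (z - a)).flatMap g := by
  induction l generalizing a with
  | nil => simpa using hf
  | cons b l ih =>
    simp only [List.cons_append, List.zip_cons_cons, List.flatMap_cons] at hf ⊢
    have hab : a < b := List.rel_of_pairwise_cons hL (by simp)
    have hL' : (b :: (l ++ [z])).Pairwise (· < ·) := (List.pairwise_cons.1 hL).2
    have hbz : b < z := List.rel_of_pairwise_cons hL' (by simp)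
    rw [ih b hL' fun q hq => hf q (List.mem_cons_of_mem _ hq), hf (a, b) (by simp),
      ← List.flatMap_append]
    congr 1
    have h := List.range'_append (s := a) (m := b - a) (n := z - b) (step := 1)
    rw [show a + 1 * (b - a) = b by omega, show b - a + (z - b) = z - a by omega] at h
    exact h

theorem eq_of_differences_eq (a : ℕ) (l m : List ℕ) (hl : (a :: l).Pairwise (· < ·))
    (hm : (a :: m).Pairwise (· < ·))
    (h : ((a :: l).zip l).map (fun q => q.2 - q.1) =
      ((a :: m).zip m).map (fun q => q.2 - q.1)) : l = m := by
  induction l generalizing a m with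
  | nil => cases m <;> simp_all
  | cons b l ih =>
    cases m with
    | nil => simp at h
    | cons c m =>
      simp only [List.zip_cons_cons, List.map_cons, List.cons.injEq] at h
      have hb : a < b := List.rel_of_pairwise_cons hl (by simp)
      have hc : a < c := List.rel_of_pairwise_cons hm (by simp)
      obtain rfl : b = c := by omega
      rw [ih b m (List.pairwise_cons.1 hl).2 (List.pairwise_cons.1 hm).2 h.2]

/-- The number of elements of `S` starting at `v` and ending at or before `r`. -/
def outDegree (S : Finset (ℕ × ℕ)) (r v : ℕ) : ℕ :=
  (S.filter fun c => c.1 = v ∧ c.2 ≤ r).card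

/-- The fan with origin `v`, as read off from the out-degree of `v`. -/
def outFan (S : Finset (ℕ × ℕ)) (r v : ℕ) : List (ℕ × ℕ) :=
  if outDegree S r v = 0 then [] else [(v, outDegree S r v)]

theorem mem_outFan {S : Finset (ℕ × ℕ)} {r v : ℕ} {x : ℕ × ℕ} :
    x ∈ outFan S r v ↔ x.1 = v ∧ x.2 = outDegree S r v ∧ x.2 ≠ 0 := by
  unfold outFan
  split_ifs with h
  · simp only [List.not_mem_nil, h, false_iff]; tauto
  · rw [List.mem_singleton, Prod.ext_iff]
    constructor
    · rintro ⟨h1, h2⟩; exact ⟨h1, h2, by omega⟩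
    · rintro ⟨h1, h2, -⟩; exact ⟨h1, h2⟩

theorem pairwise_fst_flatMap_outFan (S : Finset (ℕ × ℕ)) (r a k : ℕ) :
    (((List.range' a k).flatMap (outFan S r)).map Prod.fst).Pairwise (· < ·) := by
  rw [List.pairwise_map, List.pairwise_flatMap]
  constructor
  · intro v _
    unfold outFan
    split_ifs <;> simp
  · refine (List.pairwise_lt_range' (s := a) (n := k)).imp ?_
    intro v w hvw x hx y hy
    rw [mem_outFan] at hx hy
    omega

namespace IsTriangulation

variable {n : ℕ} {S : Finset (ℕ × ℕ)}

/-- If `(p, w)` lies in a triangulation and `w' < w`, then so does `(p, w')`, provided that no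
chord starting after `p` crosses it. -/
theorem mem_of_lt (hS : IsTriangulation n S) {p w w' : ℕ} (hw : (p, w) ∈ S) (hlt : w' < w)
    (hp : p + 1 < w') (h : ∀ c ∈ S, p < c.1 → ¬Crosses (p, w') c) : (p, w') ∈ S := by
  have hc := hS.1.1 _ hw
  simp only [IsChord] at hc
  refine hS.2 _ ⟨hc.1, hp, by omega, by simp only; omega⟩ fun d hd hX => ?_
  by_cases hpd : p < d.1
  · exact h d hd hpd hX
  · have hne : (p, w) ≠ d := by
      rintro rfl
      simp [Crosses] at hX
    apply hS.1.2 _ hw d hd hne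
    simp only [Crosses] at hX ⊢
    omega

/-- A triangulation is determined by the number of chords starting at each vertex. -/
theorem eq_of_card_filter_fst_eq {S' : Finset (ℕ × ℕ)} (hS : IsTriangulation n S)
    (hS' : IsTriangulation n S')
    (hcard : ∀ v, (S.filter fun c => c.1 = v).card = (S'.filter fun c => c.1 = v).card) :
    S = S' := by
  have hstep : ∀ {A B : Finset (ℕ × ℕ)}, IsTriangulation n A → IsTriangulation n B →
      ∀ p, (∀ c : ℕ × ℕ, p < c.1 → (c ∈ A ↔ c ∈ B)) →
      ∀ w w', (p, w) ∈ A → (p, w') ∈ B → w' < w → (p, w') ∈ A := by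
    intro A B hA hB p hAB w w' hw hw' hlt
    refine hA.mem_of_lt hw hlt (hB.1.1 _ hw').2.1 fun c hc hpc => ?_
    refine hB.1.2 _ hw' c ((hAB c hpc).1 hc) ?_
    rintro rfl
    exact lt_irrefl _ hpc
  have key : ∀ k p, n < p + k → ∀ c : ℕ × ℕ, c.1 = p → (c ∈ S ↔ c ∈ S') := by
    intro k
    induction k with
    | zero =>
      intro p hp c hc
      constructor <;> intro h
      · have := hS.1.1 c h
        simp only [IsChord] at this
        omega
      · have := hS'.1.1 c h
        simp only [IsChord] at this
        omega
    | succ k ih =>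
      intro p hp
      have hAB : ∀ c : ℕ × ℕ, p < c.1 → (c ∈ S ↔ c ∈ S') := fun c hc =>
        ih c.1 (by omega) c rfl
      have hsub : (S.filter fun c => c.1 = p) = S'.filter fun c => c.1 = p := by
        by_cases h : (S.filter fun c => c.1 = p) ⊆ S'.filter fun c => c.1 = p
        · exact Finset.eq_of_subset_of_card_le h (hcard p).ge
        · refine (Finset.eq_of_subset_of_card_le ?_ (hcard p).le).symm
          obtain ⟨⟨q, w⟩, hx, hx'⟩ := Finset.not_subset.1 h
          rintro ⟨q', w'⟩ hy
          simp only [Finset.mem_filter] at hx hx' hy ⊢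
          obtain ⟨hx, rfl⟩ := hx
          obtain ⟨hy, rfl⟩ := hy
          refine ⟨?_, rfl⟩
          rcases lt_trichotomy w w' with hlt | rfl | hlt
          · exact absurd
              ⟨hstep hS' hS _ (fun c hc => (hAB c hc).symm) _ _ hy hx hlt, rfl⟩ hx'
          · exact hx
          · exact hstep hS hS' _ hAB _ _ hx hy hlt
      intro c hc
      simpa [hc] using Finset.ext_iff.1 hsub c
  ext c
  exact key (n + 1) c.1 (by omega) c rfl

/-- The fan decomposition on the sub-polygon cut off by an edge `(p, r)` lists the vertices of
positive out-degree in increasing order, where the side `(1, n)` counts as starting at `1`. -/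
theorem fanListAux_eq (hS : IsTriangulation n S) (hn : 3 ≤ n) (fuel p r : ℕ)
    (hfuel : r - p ≤ fuel) (hpr : p < r) (hp : 1 ≤ p) (hr : r ≤ n)
    (hedge : r = p + 1 ∨ (p, r) ∈ insert (1, n) S) :
    fanListAux S fuel p r =
      (List.range' p (r - p)).flatMap (outFan (insert (1, n) S) r) := by
  have hchord : ∀ x y, (x, y) ∈ S → 1 ≤ x ∧ x + 1 < y ∧ y ≤ n ∧ ¬(x = 1 ∧ y = n) :=
    fun x y h => hS.1.1 _ h
  have hcross : ∀ x y x' y', (x, y) ∈ insert (1, n) S → (x', y') ∈ insert (1, n) S →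
      ¬(x < x' ∧ x' < y ∧ y < y') := by
    intro x y x' y' h h' hX
    simp only [Finset.mem_insert, Prod.mk.injEq] at h h'
    rcases h with h | h <;> rcases h' with h' | h'
    · omega
    · have := hchord _ _ h'; omega
    · have := hchord _ _ h; omega
    · refine hS.1.2 _ h _ h' ?_ (Or.inl hX)
      rw [Ne, Prod.mk.injEq]
      omega
  have hlong : ∀ x y, (x, y) ∈ insert (1, n) S → 1 ≤ x ∧ x + 1 < y := by
    intro x y h
    simp only [Finset.mem_insert, Prod.mk.injEq] at h
    rcases h with h | h
    · omega
    · have := hchord _ _ h; omega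
  induction fuel generalizing p r with
  | zero => omega
  | succ fuel ih =>
    rw [fanListAux]
    split_ifs with hshort
    · obtain rfl : r = p + 1 := by omega
      have h0 : outDegree (insert (1, n) S) (p + 1) p = 0 := by
        rw [outDegree, Finset.card_eq_zero, Finset.filter_eq_empty_iff]
        rintro ⟨x, y⟩ hc ⟨hx, hy⟩
        have := hlong x y hc
        simp only at hx hy
        omega
      simp [outFan, h0]
    · replace hedge : (p, r) ∈ insert (1, n) S := hedge.resolve_left (by omega)
      have hmemW : ∀ w, w ∈ ((S.filter fun c => c.1 = p ∧ p + 1 < c.2 ∧ c.2 < r).image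
          Prod.snd) ↔ (p, w) ∈ S ∧ w < r := by
        intro w
        simp only [Finset.mem_image, Finset.mem_filter, Prod.exists, exists_eq_right]
        constructor
        · rintro ⟨x, h, rfl, -, h'⟩
          exact ⟨h, h'⟩
        · rintro ⟨h, h'⟩
          exact ⟨p, h, rfl, (hchord _ _ h).2.1, h'⟩
      have hdeg : outDegree (insert (1, n) S) r p =
          ((S.filter fun c => c.1 = p ∧ p + 1 < c.2 ∧ c.2 < r).image Prod.snd).card + 1 := by
        rw [← Finset.card_insert_of_notMem (a := r) (by simp [hmemW]), outDegree,
          ← Finset.card_image_of_injOn (f := Prod.snd)]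
        · congr 1
          ext w
          rw [Finset.mem_insert, hmemW]
          simp only [Finset.mem_image, Finset.mem_filter, Prod.exists, exists_eq_right]
          constructor
          · rintro ⟨x, h, rfl, hw⟩
            rcases hw.eq_or_lt with rfl | hlt
            · exact Or.inl rfl
            · refine Or.inr ⟨(Finset.mem_insert.1 h).resolve_left ?_, hlt⟩
              rw [Prod.mk.injEq]
              omega
          · rintro (rfl | ⟨h, h'⟩)
            · exact ⟨p, hedge, rfl, le_rfl⟩
            · exact ⟨p, Finset.mem_insert_of_mem h, rfl, h'.le⟩
        · rintro ⟨x, y⟩ hc ⟨x', y'⟩ hc' h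
          simp only [Finset.coe_filter, Set.mem_ofPred_eq] at hc hc' h
          rw [Prod.mk.injEq]
          omega
      generalize ((S.filter fun c => c.1 = p ∧ p + 1 < c.2 ∧ c.2 < r).image Prod.snd) = W
        at hmemW hdeg ⊢
      have hlist : ((p + 1) :: (W.sort (· ≤ ·) ++ [r])).Pairwise (· < ·) := by
        simp only [List.pairwise_cons, List.pairwise_append, List.mem_append, Finset.mem_sort,
          hmemW, List.mem_singleton]
        refine ⟨?_, W.sortedLT_sort.pairwise, by simp, ?_⟩
        · rintro w (⟨h, -⟩ | rfl)
          · exact (hchord _ _ h).2.1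
          · omega
        · rintro w ⟨-, h⟩ _ rfl
          exact h
      have hhead : outFan (insert (1, n) S) r p = [(p, (W.sort (· ≤ ·)).length + 1)] := by
        rw [outFan, hdeg, if_neg (by omega), Finset.length_sort]
      have hrange : List.range' p (r - p) = p :: List.range' (p + 1) (r - (p + 1)) := by
        rw [show r - p = (r - (p + 1)) + 1 by omega, List.range'_succ]
      rw [hrange, List.flatMap_cons, hhead, List.singleton_append]
      simp only [List.tail_cons]
      congr 1
      apply flatMap_zip_tail_eq_flatMap_range' _ _ r _ (p + 1) hlist
      rintro ⟨a, b⟩ hq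
      obtain ⟨ha, hb, hab, hgap⟩ := mem_zip_tail_of_pairwise_lt hlist (by simpa using hq)
      simp only [List.mem_cons, List.mem_append, Finset.mem_sort, hmemW, List.not_mem_nil,
        or_false] at ha hb hgap hab
      have hpb : b = p + 1 ∨ (p, b) ∈ insert (1, n) S := by
        rcases hb with hb | hb | rfl
        · exact Or.inl hb
        · exact Or.inr (Finset.mem_insert_of_mem hb.1)
        · exact Or.inr hedge
      have hpa : a = p + 1 ∨ (p, a) ∈ insert (1, n) S := by
        rcases ha with ha | ha | rfl
        · exact Or.inl ha
        · exact Or.inr (Finset.mem_insert_of_mem ha.1)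
        · exact Or.inr hedge
      have hpa' : p < a := by
        rcases hpa with h | h
        · omega
        · have := hlong _ _ h; omega
      replace hpb : (p, b) ∈ insert (1, n) S := hpb.resolve_left (by omega)
      have hbr : b ≤ r := by
        rcases hb with hb | hb | hb <;> omega
      simp only
      rw [ih a b (by omega) hab (by omega) (by omega) ?_]
      · refine List.flatMap_congr fun v hv => ?_
        rw [List.mem_range'_1] at hv
        have : outDegree (insert (1, n) S) b v = outDegree (insert (1, n) S) r v := by
          unfold outDegree
          congr 1
          refine Finset.filter_congr ?_
          rintro ⟨x, y⟩ hc
          have := hcross p b x y hpb hc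
          simp only
          omega
        rw [outFan, outFan, this]
      · by_cases hside : b = a + 1
        · exact Or.inl hside
        · refine Or.inr (Finset.mem_insert_of_mem (hS.2 _ ?_ ?_))
          · refine ⟨?_, ?_, ?_, ?_⟩ <;> simp only <;> omega
          · rintro ⟨x, y⟩ hd hX
            have hd' : (x, y) ∈ insert (1, n) S := Finset.mem_insert_of_mem hd
            have hxy := hchord _ _ hd
            have h1 := hcross _ _ _ _ hpb hd'
            have h2 := hcross _ _ _ _ hd' hedge
            simp only [Crosses] at hX
            rcases hX with hX | hX
            · omega
            · rcases lt_trichotomy x p with hxp | rfl | hxp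
              · omega
              · have := hgap y (Or.inr (Or.inl ⟨hd, by omega⟩))
                omega
              · rcases hpa with h | h
                · omega
                · have := hcross _ _ _ _ h hd'
                  omega

theorem fanList_eq (hS : IsTriangulation n S) (hn : 3 ≤ n) :
    fanList S 1 n = (List.range' 1 (n - 1)).flatMap (outFan (insert (1, n) S) n) :=
  hS.fanListAux_eq hn _ _ _ le_rfl (by omega) le_rfl le_rfl (by simp)

theorem card_filter_fst_eq_of_forall_outDegree_eq {S' : Finset (ℕ × ℕ)}
    (hS : IsTriangulation n S) (hS' : IsTriangulation n S')
    (h : ∀ v, 1 ≤ v → v < n →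
      outDegree (insert (1, n) S) n v = outDegree (insert (1, n) S') n v) (v : ℕ) :
    (S.filter fun c => c.1 = v).card = (S'.filter fun c => c.1 = v).card := by
  have hdeg : ∀ {A : Finset (ℕ × ℕ)}, IsTriangulation n A →
      outDegree (insert (1, n) A) n v =
        (A.filter fun c => c.1 = v).card + if v = 1 then 1 else 0 := by
    intro A hA
    have hfilter : (A.filter fun c => c.1 = v ∧ c.2 ≤ n) = A.filter fun c => c.1 = v :=
      Finset.filter_congr fun c hc => and_iff_left (hA.1.1 c hc).2.2.1
    have hside : (1, n) ∉ A := fun hc => (hA.1.1 _ hc).2.2.2 ⟨rfl, rfl⟩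
    rw [outDegree, Finset.filter_insert, hfilter]
    split_ifs with h1 h2 h2
    · exact Finset.card_insert_of_notMem (by simp [hside])
    · exact absurd h1.1.symm h2
    · exact absurd ⟨h2.symm, le_rfl⟩ h1
    · rfl
  by_cases hv : 1 ≤ v ∧ v < n
  · have := h v hv.1 hv.2
    rw [hdeg hS, hdeg hS'] at this
    exact Nat.add_right_cancel this
  · have hempty : ∀ {A : Finset (ℕ × ℕ)}, IsTriangulation n A →
        (A.filter fun c => c.1 = v) = ∅ := by
      intro A hA
      refine Finset.filter_eq_empty_iff.2 fun c hc hcv => ?_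
      have := hA.1.1 c hc
      simp only [IsChord] at this
      omega
    rw [hempty hS, hempty hS']

theorem fanList_cons (hS : IsTriangulation n S) (hn : 3 ≤ n) :
    ∃ k L, fanList S 1 n = (1, k) :: L := by
  obtain ⟨m, rfl⟩ : ∃ m, n = m + 3 := ⟨n - 3, by omega⟩
  rw [fanList, show m + 3 - 1 = m + 1 + 1 from rfl, fanListAux, if_neg (by omega)]
  exact ⟨_, _, rfl⟩

theorem pairwise_map_fst_fanList (hS : IsTriangulation n S) (hn : 3 ≤ n) :
    ((fanList S 1 n).map Prod.fst).Pairwise (· < ·) := by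
  rw [hS.fanList_eq hn]
  exact pairwise_fst_flatMap_outFan _ _ _ _

theorem mem_fanList (hS : IsTriangulation n S) (hn : 3 ≤ n) {v k : ℕ} :
    (v, k) ∈ fanList S 1 n ↔
      1 ≤ v ∧ v < n ∧ k = outDegree (insert (1, n) S) n v ∧ k ≠ 0 := by
  rw [hS.fanList_eq hn, List.mem_flatMap]
  simp only [List.mem_range'_1, mem_outFan]
  constructor
  · rintro ⟨w, hw, rfl, h⟩
    exact ⟨hw.1, by omega, h⟩
  · rintro ⟨h1, h2, h⟩
    exact ⟨v, ⟨h1, by omega⟩, rfl, h⟩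

theorem eq_of_fanList_eq {S' : Finset (ℕ × ℕ)} (hS : IsTriangulation n S)
    (hS' : IsTriangulation n S') (hn : 3 ≤ n) (h : fanList S 1 n = fanList S' 1 n) : S = S' := by
  refine hS.eq_of_card_filter_fst_eq hS' (hS.card_filter_fst_eq_of_forall_outDegree_eq hS' ?_)
  intro v hv hvn
  have hiff : ∀ k, _ ↔ _ := fun k =>
    (hS.mem_fanList hn (v := v) (k := k)).symm.trans (h ▸ hS'.mem_fanList hn)
  have h1 := hiff (outDegree (insert (1, n) S) n v)
  have h2 := hiff (outDegree (insert (1, n) S') n v)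
  omega

end IsTriangulation

/-- The fan decomposition uniquely determines a triangulation: if two triangulations of
the `n`-gon have fan decompositions with the same sequences of fan sizes and the same
sequences of origin-label differences, they are equal. -/
theorem fan_decomposition_determines (n : ℕ) (S S' : Finset (ℕ × ℕ))
    (hS : IsTriangulation n S) (hS' : IsTriangulation n S')
    (hsizes : (fanList S 1 n).map Prod.snd = (fanList S' 1 n).map Prod.snd)
    (hdelta : deltaList (fanList S 1 n) = deltaList (fanList S' 1 n)) :
    S = S' := by
  rcases lt_or_ge n 3 with hn | hn
  · have hempty : ∀ {A : Finset (ℕ × ℕ)}, IsTriangulation n A → A = ∅ := by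
      intro A hA
      refine Finset.eq_empty_of_forall_notMem fun c hc => ?_
      have := hA.1.1 c hc
      simp only [IsChord] at this
      omega
    rw [hempty hS, hempty hS']
  · refine hS.eq_of_fanList_eq hS' hn ?_
    have hlt := hS.pairwise_map_fst_fanList hn
    have hlt' := hS'.pairwise_map_fst_fanList hn
    obtain ⟨k, L, hL⟩ := hS.fanList_cons hn
    obtain ⟨k', L', hL'⟩ := hS'.fanList_cons hn
    rw [hL] at hsizes hdelta hlt ⊢
    rw [hL'] at hsizes hdelta hlt' ⊢
    have hfst : ((1, k) :: L).map Prod.fst = ((1, k') :: L').map Prod.fst :=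
      congrArg (1 :: ·) (eq_of_differences_eq 1 _ _ hlt hlt' hdelta)
    rw [← List.zip_unzip ((1, k) :: L), ← List.zip_unzip ((1, k') :: L'),
      List.unzip_eq_map, List.unzip_eq_map, hfst, hsizes]
end

section
/- Let T be a triangulation in Tri(n,t,s), let F_1,…,F_{t+s} be the fans of its fan decomposition with u_j the number of triangles of F_j, let (d_1,…,d_{t+s−1}) = δ(T), and let d_{t+s} be the number of boundary edges from the origin of F_{t+s} counterclockwise back to the origin of F_1, minus 2. Then the word U^{u_1} D^{d_1} U^{u_2} D^{d_2} ⋯ U^{u_{t+s}} D^{d_{t+s}} is a Dyck path of semilength n−2 belonging to Dyck(n−2, t, s). -/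
/-! ## Bounds on the fans of an interval -/

/-- Every fan of `L` has its origin at most `c` plus the total size of the preceding fans. -/
def OriginsReachable : ℕ → List (ℕ × ℕ) → Prop
  | _, [] => True
  | c, x :: L => x.1 ≤ c ∧ OriginsReachable (c + x.2) L

theorem OriginsReachable.mono {L : List (ℕ × ℕ)} {c d : ℕ} (hcd : c ≤ d)
    (h : OriginsReachable c L) : OriginsReachable d L := by
  induction L generalizing c d with
  | nil => trivial
  | cons x L ih => exact ⟨h.1.trans hcd, ih (by omega) h.2⟩

theorem OriginsReachable.append {L M : List (ℕ × ℕ)} {c : ℕ} (hL : OriginsReachable c L)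
    (hM : OriginsReachable (c + (L.map Prod.snd).sum) M) : OriginsReachable c (L ++ M) := by
  induction L generalizing c with
  | nil => simpa using hM
  | cons x L ih =>
    refine ⟨hL.1, ih hL.2 ?_⟩
    simpa [add_assoc] using hM

/-- The properties shared by the fan lists of `k + 1` consecutive polygons
on the vertex interval `[p, r]`. -/
structure IsIntervalFans (k p r : ℕ) (L : List (ℕ × ℕ)) : Prop where
  sum_add : (L.map Prod.snd).sum + p + k + 1 = r
  reachable : OriginsReachable (p + k) L
  pairwise : L.Pairwise fun x y => x.1 < y.1
  bounds : ∀ x ∈ L, p ≤ x.1 ∧ x.1 + 2 ≤ r ∧ 1 ≤ x.2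

theorem IsIntervalFans.append {k p q r : ℕ} {L M : List (ℕ × ℕ)} (hL : IsIntervalFans 0 p q L)
    (hM : IsIntervalFans k q r M) : IsIntervalFans (k + 1) p r (L ++ M) := by
  have h1 := hL.sum_add
  have h2 := hM.sum_add
  refine ⟨?_, ?_, ?_, ?_⟩
  · rw [List.map_append, List.sum_append]
    omega
  · exact (hL.reachable.mono (by omega)).append (hM.reachable.mono (by omega))
  · refine List.pairwise_append.2 ⟨hL.pairwise, hM.pairwise, fun x hx y hy => ?_⟩
    have := hL.bounds x hx
    have := hM.bounds y hy
    omega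
  · intro x hx
    rcases List.mem_append.1 hx with hx | hx
    · have := hL.bounds x hx
      omega
    · have := hM.bounds x hx
      omega

theorem isIntervalFans_flatMap_zip (g : ℕ × ℕ → List (ℕ × ℕ)) (r : ℕ) (ws : List ℕ) (p : ℕ)
    (hw : (p :: (ws ++ [r])).Pairwise (· < ·))
    (hg : ∀ a b, p ≤ a → a < b → b ≤ r → IsIntervalFans 0 a b (g (a, b))) :
    IsIntervalFans ws.length p r
      (((p :: (ws ++ [r])).zip (p :: (ws ++ [r])).tail).flatMap g) := by
  induction ws generalizing p with
  | nil =>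
    have hpr : p < r := by simpa using hw
    simpa using hg p r le_rfl hpr le_rfl
  | cons w ws ih =>
    rw [List.cons_append, List.pairwise_cons] at hw
    have hpw : p < w := hw.1 w (by simp)
    have hwr : w < r := (List.pairwise_cons.1 hw.2).1 r (by simp)
    simpa using (hg p w le_rfl hpw hwr.le).append
      (ih w hw.2 fun a b ha hab hb => hg a b (by omega) hab hb)

theorem isIntervalFans_fanListAux (S : Finset (ℕ × ℕ)) (fuel p r : ℕ) (hpr : p < r)
    (hfuel : r ≤ fuel + p) : IsIntervalFans 0 p r (fanListAux S fuel p r) := by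
  induction fuel generalizing p r with
  | zero => omega
  | succ fuel ih =>
    rw [fanListAux]
    split_ifs with h
    · refine ⟨?_, trivial, List.Pairwise.nil, by simp⟩
      simp
      omega
    · extract_lets ws link
      have hmem : ∀ w ∈ ws, p + 1 < w ∧ w < r := by
        intro w hw
        simp only [ws, Finset.mem_sort, Finset.mem_image, Finset.mem_filter] at hw
        obtain ⟨c, ⟨-, -, h1, h2⟩, rfl⟩ := hw
        exact ⟨h1, h2⟩
      have hsorted : ws.Pairwise (· < ·) := (Finset.sortedLT_sort _).pairwise
      have hlink : link.Pairwise (· < ·) := by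
        refine List.pairwise_cons.2 ⟨fun w hw => ?_, List.pairwise_append.2
          ⟨hsorted, List.pairwise_singleton _ _, fun a ha b hb => ?_⟩⟩
        · rcases List.mem_append.1 hw with hw | hw
          · exact (hmem w hw).1
          · rw [List.mem_singleton.1 hw]
            omega
        · rw [List.mem_singleton.1 hb]
          exact (hmem a ha).2
      have key : IsIntervalFans ws.length (p + 1) r
          ((link.zip link.tail).flatMap fun q => fanListAux S fuel q.1 q.2) :=
        isIntervalFans_flatMap_zip _ r ws (p + 1) hlink fun a b ha hab hb => ih a b hab (by omega)
      have hsum := key.sum_add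
      refine ⟨?_, ⟨le_rfl, key.reachable.mono (by dsimp only; omega)⟩,
        List.pairwise_cons.2 ⟨fun x hx => (key.bounds x hx).1, key.pairwise⟩, fun x hx => ?_⟩
      · rw [List.map_cons, List.sum_cons]
        dsimp only
        omega
      · rcases List.mem_cons.1 hx with rfl | hx
        · dsimp only
          omega
        · have := key.bounds x hx
          omega

theorem fanList_eq_cons (S : Finset (ℕ × ℕ)) {p r : ℕ} (h : p + 1 < r) :
    ∃ u L, fanList S p r = (p, u) :: L := by
  obtain ⟨m, hm⟩ : ∃ m, r - p = m + 1 := ⟨r - p - 1, by omega⟩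
  rw [fanList, hm, fanListAux, if_neg (by omega)]
  exact ⟨_, _, rfl⟩

/-! ## The word of a list of fans -/

/-- The word `U^{u_1} D^{x_2-x_1} ⋯ U^{u_k} D^{e-x_k}` of a list of pairs `(x_j, u_j)`. -/
def fanWord (e : ℕ) : List (ℕ × ℕ) → List Bool
  | [] => []
  | x :: L => List.replicate x.2 true ++
      (List.replicate ((L.map Prod.fst).headD e - x.1) false ++ fanWord e L)

theorem flatMap_zip_deltaList (e : ℕ) (L : List (ℕ × ℕ)) :
    (((L.map Prod.snd).zip (deltaList L ++ [e - (L.map Prod.fst).getLastD 0])).flatMap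
      fun q => List.replicate q.1 true ++ List.replicate q.2 false) = fanWord e L := by
  induction L with
  | nil => simp [fanWord]
  | cons x L ih =>
    cases L with
    | nil => simp [fanWord, deltaList]
    | cons y L =>
      rw [fanWord, ← ih]
      simp [deltaList]

theorem triWord_eq_fanWord (n : ℕ) (S : Finset (ℕ × ℕ)) :
    triWord n S = fanWord (n - 1) (fanList S 1 n) := by
  rw [← flatMap_zip_deltaList, triWord]
  rcases Nat.lt_or_ge (1 + 1) n with h | h
  · obtain ⟨u, L, hL⟩ := fanList_eq_cons S h
    have hd : ((fanList S 1 n).map Prod.fst).headD 0 = 1 := by simp [hL]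
    rw [hd, show ∀ m, n - m + 1 - 2 = n - 1 - m by omega]
  · have : fanList S 1 n = [] := by
      rw [fanList]
      cases n - 1 with
      | zero => rfl
      | succ m => rw [fanListAux, if_pos h]
    simp [this]

theorem lt_headD_of_pairwise {e : ℕ} {x : ℕ × ℕ} {L : List (ℕ × ℕ)}
    (hp : (x :: L).Pairwise fun x y => x.1 < y.1) (he : ∀ y ∈ x :: L, y.1 < e) :
    x.1 < (L.map Prod.fst).headD e := by
  cases L with
  | nil => simpa using he x
  | cons y L => simpa using (List.pairwise_cons.1 hp).1 y (by simp)

theorem count_true_fanWord (e : ℕ) (L : List (ℕ × ℕ)) :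
    (fanWord e L).count true = (L.map Prod.snd).sum := by
  induction L with
  | nil => rfl
  | cons x L ih => simp [fanWord, ih, List.count_replicate]

theorem count_false_fanWord {e : ℕ} {L : List (ℕ × ℕ)}
    (hp : L.Pairwise fun x y => x.1 < y.1) (he : ∀ y ∈ L, y.1 < e) :
    (fanWord e L).count false + (L.map Prod.fst).headD e = e := by
  induction L with
  | nil => simp [fanWord]
  | cons x L ih =>
    have h1 := lt_headD_of_pairwise hp he
    have h2 := ih hp.of_cons fun y hy => he y (List.mem_cons_of_mem _ hy)
    simp only [fanWord, List.count_append, List.count_replicate, List.map_cons, List.headD_cons]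
    simp
    simp at h1 h2
    omega

theorem splitBy_beq_replicate_append {α : Type*} [BEq α] [LawfulBEq α] {a : α} {k : ℕ}
    (hk : k ≠ 0) {w : List α} (hw : ∀ b ∈ w.head?, b ≠ a) :
    (List.replicate k a ++ w).splitBy (· == ·) =
      List.replicate k a :: w.splitBy (· == ·) := by
  rw [List.splitBy_append, List.splitBy_of_isChain]
  · rfl
  · simpa using hk
  · exact (List.pairwise_replicate.2 (Or.inr (by simp))).isChain
  · intro x hx y hy
    obtain rfl := List.eq_of_mem_replicate (List.mem_of_mem_getLast? hx)
    simpa using (hw y hy).symm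

theorem ascentLengths_replicate_append_s14 {a b : ℕ} (ha : a ≠ 0) (hb : b ≠ 0) {w : List Bool}
    (hw : w.head? ≠ some false) :
    ascentLengths (List.replicate a true ++ (List.replicate b false ++ w)) =
      a :: ascentLengths w := by
  obtain ⟨a, rfl⟩ := Nat.exists_eq_succ_of_ne_zero ha
  obtain ⟨b, rfl⟩ := Nat.exists_eq_succ_of_ne_zero hb
  rw [ascentLengths, splitBy_beq_replicate_append (by simp) (by simp [List.replicate_succ]),
    splitBy_beq_replicate_append (by simp)]
  · simp [ascentLengths, List.replicate_succ, List.filter_cons]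
  · rintro (_ | _) h
    · exact absurd h hw
    · simp

theorem ascentLengths_fanWord {e : ℕ} {L : List (ℕ × ℕ)}
    (hp : L.Pairwise fun x y => x.1 < y.1) (he : ∀ y ∈ L, y.1 < e) (hu : ∀ y ∈ L, 1 ≤ y.2) :
    ascentLengths (fanWord e L) = L.map Prod.snd := by
  induction L with
  | nil => rfl
  | cons x L ih =>
    have h1 := lt_headD_of_pairwise hp he
    have h2 := hu x (by simp)
    rw [fanWord, ascentLengths_replicate_append_s14 (by omega) (by omega), List.map_cons,
      ih hp.of_cons (fun y hy => he y (List.mem_cons_of_mem _ hy))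
        fun y hy => hu y (List.mem_cons_of_mem _ hy)]
    cases L with
    | nil => simp [fanWord]
    | cons y L =>
      obtain ⟨k, hk⟩ := Nat.exists_eq_succ_of_ne_zero (Nat.one_le_iff_ne_zero.1 (hu y (by simp)))
      simp [fanWord, hk, List.replicate_succ]

/-- Starting from height `h`, the word `w` never goes below height `0`. -/
def StaysNonneg (h : ℕ) (w : List Bool) : Prop :=
  ∀ p, p <+: w → p.count false ≤ h + p.count true

theorem StaysNonneg.replicate_true_append {h k : ℕ} {w : List Bool} (hw : StaysNonneg (h + k) w) :
    StaysNonneg h (List.replicate k true ++ w) := by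
  induction k generalizing h with
  | zero => simpa using hw
  | succ k ih =>
    intro p hp
    rw [List.replicate_succ, List.cons_append, List.prefix_cons_iff] at hp
    obtain rfl | ⟨q, rfl, hq⟩ := hp
    · simp
    · have := ih (h := h + 1) (by rwa [add_assoc, add_comm 1]) q hq
      simp
      omega

theorem StaysNonneg.replicate_false_append {h k : ℕ} {w : List Bool} (hw : StaysNonneg h w) :
    StaysNonneg (h + k) (List.replicate k false ++ w) := by
  induction k with
  | zero => simpa using hw
  | succ k ih =>
    intro p hp
    rw [List.replicate_succ, List.cons_append, List.prefix_cons_iff] at hp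
    obtain rfl | ⟨q, rfl, hq⟩ := hp
    · simp
    · have := ih q hq
      simp
      omega

theorem staysNonneg_fanWord {e c h : ℕ} {L : List (ℕ × ℕ)}
    (hp : L.Pairwise fun x y => x.1 < y.1) (he : ∀ y ∈ L, y.1 < e)
    (hL : OriginsReachable c L) (hsum : e ≤ c + (L.map Prod.snd).sum)
    (hh : c = h + (L.map Prod.fst).headD e) : StaysNonneg h (fanWord e L) := by
  induction L generalizing c h with
  | nil => simp [fanWord, StaysNonneg]
  | cons x L ih =>
    have h1 := lt_headD_of_pairwise hp he
    rw [List.map_cons, List.headD_cons] at hh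
    rw [List.map_cons, List.sum_cons] at hsum
    have h2 : (L.map Prod.fst).headD e ≤ c + x.2 := by
      cases L with
      | nil => simpa using hsum
      | cons y L => simpa using hL.2.1
    rw [fanWord]
    apply StaysNonneg.replicate_true_append
    obtain ⟨m, hm⟩ : ∃ m, h + x.2 = m + ((L.map Prod.fst).headD e - x.1) :=
      ⟨h + x.2 - ((L.map Prod.fst).headD e - x.1), by omega⟩
    rw [hm]
    apply StaysNonneg.replicate_false_append
    exact ih hp.of_cons (fun y hy => he y (List.mem_cons_of_mem _ hy)) hL.2 (by omega) (by omega)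

theorem length_filter_two_le {l : List ℕ} (hl : ∀ x ∈ l, 1 ≤ x) :
    (l.filter fun x => decide (2 ≤ x)).length +
      (l.filter fun x => decide (x = 1)).length = l.length := by
  induction l with
  | nil => rfl
  | cons x l ih =>
    have h1 := ih fun y hy => hl y (List.mem_cons_of_mem _ hy)
    have h2 := hl x (by simp)
    rcases h2.eq_or_lt with rfl | h3
    · simp
      omega
    · have h4 : x ≠ 1 := by omega
      have h5 : 2 ≤ x := h3
      simp [h4, h5]
      omega

theorem exists_lt_two_le_getD {l : List ℕ} (hl : ∀ x ∈ l, 1 ≤ x) (hlast : l.getLastD 0 ≠ 1)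
    {j : ℕ} (hj : l.getD j 0 = 1) : ∃ k, j < k ∧ 2 ≤ l.getD k 0 := by
  have hjl : j < l.length := by
    by_contra h
    rw [List.getD_eq_default _ _ (by omega)] at hj
    omega
  have hne : l ≠ [] := by
    rintro rfl
    simp at hjl
  have hget : l.getD (l.length - 1) 0 = l.getLastD 0 := by
    rw [List.getLastD_eq_getLast?, List.getLast?_eq_getElem?, List.getD_eq_getElem?_getD]
  have h1 : 1 ≤ l.getLastD 0 := by
    refine hl _ ?_
    rw [← hget, List.getD_eq_getElem _ _ (by omega)]
    exact List.getElem_mem _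
  refine ⟨l.length - 1, ?_, by omega⟩
  by_contra h
  have : j = l.length - 1 := by omega
  rw [this, hget] at hj
  exact hlast hj

/-- For a triangulation `T ∈ Tri(n,t,s)` with fan sizes `u_j` and origin distances `d_j`
(the last distance being the number of boundary edges from the last origin
counterclockwise back to the first origin, minus 2), the word
`U^{u_1} D^{d_1} ⋯ U^{u_{t+s}} D^{d_{t+s}}` is a Dyck path in `Dyck(n-2, t, s)`. -/
theorem triWord_mem_dyckSet (n t s : ℕ) (S : Finset (ℕ × ℕ)) (hS : S ∈ TriSet n t s) :
    triWord n S ∈ DyckSet (n - 2) t s := by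
  obtain ⟨-, hlen, hs, hlast⟩ := hS
  rw [triWord_eq_fanWord]
  rcases Nat.lt_or_ge 1 n with hn | hn
  · have hF : IsIntervalFans 0 1 n (fanList S 1 n) :=
      isIntervalFans_fanListAux S (n - 1) 1 n hn (by omega)
    have hhead : ((fanList S 1 n).map Prod.fst).headD (n - 1) = 1 := by
      rcases Nat.lt_or_ge (1 + 1) n with h | h
      · obtain ⟨u, L, hL⟩ := fanList_eq_cons S h
        simp [hL]
      · obtain rfl : n = 2 := by omega
        simp [fanList, fanListAux]
    generalize fanList S 1 n = L at *
    have he : ∀ x ∈ L, x.1 < n - 1 := fun x hx => by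
      have := hF.bounds x hx
      omega
    have hu : ∀ x ∈ L, 1 ≤ x.2 := fun x hx => (hF.bounds x hx).2.2
    have hu' : ∀ u ∈ L.map Prod.snd, 1 ≤ u := by simpa using fun a b h => hu (b, a) h
    have hsum := hF.sum_add
    have htrue := count_true_fanWord (n - 1) L
    have hfalse := count_false_fanWord hF.pairwise he
    have hsing : ((L.map Prod.snd).filter fun x => decide (x = 1)).length = s := by
      rw [List.filter_map, List.length_map]
      exact hs
    have hlong := length_filter_two_le hu'
    rw [List.length_map] at hlong
    rw [hhead] at hfalse
    have hasc := ascentLengths_fanWord hF.pairwise he hu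
    refine ⟨?_, by omega, ?_, ?_, ?_, ?_⟩
    · have := List.count_true_add_count_false (fanWord (n - 1) L)
      omega
    · have := staysNonneg_fanWord (h := 0) hF.pairwise he hF.reachable (by omega) (by omega)
      simpa [StaysNonneg] using this
    · rw [hasc]
      omega
    · rw [hasc]
      exact hsing
    · rw [hasc]
      intro j
      refine exists_lt_two_le_getD hu' ?_
      rw [show (0 : ℕ) = Prod.snd ((0, 0) : ℕ × ℕ) from rfl, List.getLastD_map]
      exact hlast
  · have hnil : fanList S 1 n = [] := by
      rw [fanList, Nat.sub_eq_zero_of_le hn, fanListAux]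
    rw [hnil] at hlen hs ⊢
    simp at hlen hs
    simp [DyckSet, fanWord, ascentLengths]
    omega
end
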